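/- (Franks) Let F : ℝ² → ℝ² be a homeomorphism satisfying F(x + m) = F(x) + m for all x ∈ ℝ² and m ∈ ℤ² (a lift of a torus homeomorphism isotopic to the identity), and let ρ(F) = { v ∈ ℝ² : ∃ n_k → ∞, x_k ∈ ℝ² with (F^{n_k}(x_k) − x_k)/n_k → v } be its rotation set. If v lies in the interior of ρ(F) and v = (p₁/q, p₂/q) for integers p₁, p₂ and a positive integer q, then there exists x₀ ∈ ℝ² with F^q(x₀) = x₀ + (p₁, p₂); in particular the induced torus homeomorphism has a periodic point with rotation vector v. -/

import Mathlib

open Filter Topology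

/-- A continuous nowhere vanishing function on a contractible, locally path connected space has a
continuous logarithm. -/
theorem exists_continuous_log {A : Type*} [TopologicalSpace A] [ContractibleSpace A]
    [LocallyPathConnectedSpace A] (f : A → ℂ) (hf : Continuous f) (h0 : ∀ a, f a ≠ 0) :
    ∃ g : A → ℂ, Continuous g ∧ ∀ a, Complex.exp (g a) = f a := by
  obtain ⟨a₀⟩ : Nonempty A := inferInstance
  obtain ⟨g, ⟨-, hg⟩, -⟩ := Complex.isCoveringMapOn_exp.existsUnique_continuousMap_lifts
    (⟨f, hf⟩ : C(A, ℂ)) (a₀ := a₀) (Complex.exp_log (h0 a₀)) (fun a => h0 a)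
  exact ⟨g, g.continuous, fun a => congrFun hg a⟩

/-- Two continuous logarithms of the same function on a contractible, locally path connected
space differ by a constant. -/
theorem eq_of_exp_eq_const {A : Type*} [TopologicalSpace A] [ContractibleSpace A]
    [LocallyPathConnectedSpace A] {f : A → ℂ} (hf : Continuous f) {c : ℂ}
    (h : ∀ a, Complex.exp (f a) = c) (a b : A) : f a = f b := by
  obtain ⟨g, -, hg⟩ := Complex.isCoveringMapOn_exp.existsUnique_continuousMap_lifts
    (⟨fun _ => c, continuous_const⟩ : C(A, ℂ)) (a₀ := b) (e₀ := f b) (h b)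
    (fun a => by rw [← h b]; exact Complex.exp_ne_zero _)
  have h1 := hg ⟨f, hf⟩ ⟨rfl, funext h⟩
  have h2 := hg ⟨fun _ => f b, continuous_const⟩ ⟨rfl, funext fun _ => h b⟩
  have h3 := h1.trans h2.symm
  exact congrArg (fun k : C(A, ℂ) => k a) h3

/-- A continuous self-map of the plane at bounded distance from the identity has a zero. -/
theorem exists_zero_of_dist_id_le {H : ℂ → ℂ} (hH : Continuous H) {C : ℝ}
    (hC : ∀ z, ‖H z - z‖ ≤ C) : ∃ z, H z = 0 := by
  by_contra! h0
  obtain ⟨g, hg, hge⟩ := exists_continuous_log H hH h0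
  have hC0 : 0 ≤ C := (norm_nonneg _).trans (hC 0)
  set R : ℝ := C + 1 with hR
  have hRpos : 0 < R := by positivity
  let z : ℝ → ℂ := fun θ => R * Complex.exp (θ * Complex.I)
  have hz : Continuous z := by fun_prop
  have hzn : ∀ θ, ‖z θ‖ = R := fun θ => by
    simp only [z, norm_mul, Complex.norm_exp_ofReal_mul_I, mul_one, Complex.norm_real,
      Real.norm_eq_abs, abs_of_pos hRpos]
  have hz0 : ∀ θ, z θ ≠ 0 := fun θ => by
    rw [← norm_pos_iff, hzn]; exact hRpos
  have hslit : ∀ θ, H (z θ) / z θ ∈ Complex.slitPlane := fun θ => by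
    have h1 : ‖H (z θ) / z θ - 1‖ < 1 := by
      rw [div_sub_one (hz0 θ), norm_div, hzn, div_lt_one hRpos]
      exact (hC _).trans_lt (by linarith)
    left
    have := (Complex.abs_re_le_norm (H (z θ) / z θ - 1)).trans_lt h1
    rw [abs_lt, Complex.sub_re, Complex.one_re] at this
    linarith
  let φ : ℝ → ℂ := fun θ => g (z θ) - Complex.log (H (z θ) / z θ) - θ * Complex.I
  have hφ : Continuous φ := by
    refine ((hg.comp hz).sub ?_).sub (by fun_prop)
    exact ((hH.comp hz).div hz hz0).clog hslit
  have hφe : ∀ θ, Complex.exp (φ θ) = R := fun θ => by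
    simp only [φ]
    rw [Complex.exp_sub, Complex.exp_sub, hge, Complex.exp_log (div_ne_zero (h0 _) (hz0 θ)),
      div_div_cancel₀ (h0 _)]
    simp only [z]
    field_simp [Complex.exp_ne_zero]
  have h := eq_of_exp_eq_const hφ hφe (2 * Real.pi) 0
  have hzz : z (2 * Real.pi) = z 0 := by
    simp [z]
  simp only [φ, hzz] at h
  have h2 : ((2 * Real.pi : ℝ) : ℂ) * Complex.I = ((0 : ℝ) : ℂ) * Complex.I := by
    linear_combination -h
  have h3 := mul_right_cancel₀ Complex.I_ne_zero h2
  have h4 : (2 * Real.pi) = 0 := by exact_mod_cast h3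
  linarith [Real.pi_pos]

/-- The determinant of two plane vectors. -/
def planeDet (a b : ℂ) : ℝ := a.re * b.im - a.im * b.re

/-- Two curves at bounded distance from two transverse lines intersect. -/
theorem exists_eq_of_transverse_directions {γ₁ γ₂ : ℝ → ℂ} (h₁ : Continuous γ₁)
    (h₂ : Continuous γ₂) {p q : ℂ} (hpq : planeDet p q ≠ 0) {C₁ C₂ : ℝ}
    (hC₁ : ∀ s : ℝ, ‖γ₁ s - s * p‖ ≤ C₁) (hC₂ : ∀ s : ℝ, ‖γ₂ s - s * q‖ ≤ C₂) :
    ∃ s t, γ₁ s = γ₂ t := by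
  let s : ℂ → ℝ := fun z => planeDet z q / planeDet p q
  let t : ℂ → ℝ := fun z => planeDet p z / planeDet p q
  have hs : Continuous s := by
    have : Continuous fun z : ℂ => z.re * q.im - z.im * q.re :=
      (Complex.continuous_re.mul continuous_const).sub (Complex.continuous_im.mul continuous_const)
    exact this.div_const _
  have ht : Continuous t := by
    have : Continuous fun z : ℂ => p.re * z.im - p.im * z.re :=
      (continuous_const.mul Complex.continuous_im).sub (continuous_const.mul Complex.continuous_re)
    exact this.div_const _
  have hst : ∀ z, (s z : ℂ) * p + t z * q = z := fun z => by
    have e1 : s z * planeDet p q = planeDet z q := div_mul_cancel₀ _ hpq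
    have e2 : t z * planeDet p q = planeDet p z := div_mul_cancel₀ _ hpq
    apply Complex.ext
    · apply mul_right_cancel₀ hpq
      simp only [Complex.add_re, Complex.mul_re, Complex.ofReal_re, Complex.ofReal_im, zero_mul,
        sub_zero]
      calc _ = (s z * planeDet p q) * p.re + (t z * planeDet p q) * q.re := by ring
        _ = _ := by rw [e1, e2]; simp only [planeDet]; ring
    · apply mul_right_cancel₀ hpq
      simp only [Complex.add_im, Complex.mul_im, Complex.ofReal_re, Complex.ofReal_im, zero_mul,
        add_zero]
      calc _ = (s z * planeDet p q) * p.im + (t z * planeDet p q) * q.im := by ring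
        _ = _ := by rw [e1, e2]; simp only [planeDet]; ring
  obtain ⟨z, hz⟩ := exists_zero_of_dist_id_le (H := fun z => γ₁ (s z) - γ₂ (-t z))
    ((h₁.comp hs).sub (h₂.comp ht.neg)) (C := C₁ + C₂) (fun z => by
      have : γ₁ (s z) - γ₂ (-t z) - z =
          (γ₁ (s z) - s z * p) - (γ₂ (-t z) - ((-t z : ℝ) : ℂ) * q) := by
        push_cast
        linear_combination hst z
      rw [this]
      exact (norm_sub_le _ _).trans (add_le_add (hC₁ _) (hC₂ _)))
  exact ⟨_, _, sub_eq_zero.1 hz⟩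

/-- A plane homeomorphism moves points by a bounded amount. -/
def HasBoundedDisplacement (G : ℂ ≃ₜ ℂ) : Prop := ∃ C : ℝ, ∀ z, ‖G z - z‖ ≤ C

theorem HasBoundedDisplacement.refl : HasBoundedDisplacement (Homeomorph.refl ℂ) :=
  ⟨0, fun z => by simp⟩

theorem HasBoundedDisplacement.trans {G H : ℂ ≃ₜ ℂ} (hG : HasBoundedDisplacement G)
    (hH : HasBoundedDisplacement H) : HasBoundedDisplacement (G.trans H) := by
  obtain ⟨C, hC⟩ := hG
  obtain ⟨D, hD⟩ := hH
  refine ⟨D + C, fun z => ?_⟩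
  have : (G.trans H) z - z = (H (G z) - G z) + (G z - z) := by simp
  rw [this]
  exact (norm_add_le _ _).trans (add_le_add (hD _) (hC _))

theorem HasBoundedDisplacement.symm {G : ℂ ≃ₜ ℂ} (hG : HasBoundedDisplacement G) :
    HasBoundedDisplacement G.symm := by
  obtain ⟨C, hC⟩ := hG
  refine ⟨C, fun z => ?_⟩
  have := hC (G.symm z)
  rwa [G.apply_symm_apply, norm_sub_rev] at this

/-- The Alexander isotopy of a homeomorphism with bounded displacement. -/
theorem HasBoundedDisplacement.continuous_alexander {G : ℂ ≃ₜ ℂ}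
    (hG : HasBoundedDisplacement G) :
    Continuous fun w : ℂ × ℝ => w.1 + w.2 * (G (w.1 / w.2) - w.1 / w.2) := by
  obtain ⟨C, hC⟩ := hG
  refine continuous_fst.add (continuous_iff_continuousAt.2 fun w => ?_)
  by_cases hw : w.2 = 0
  · have h0 : Tendsto (fun w : ℂ × ℝ => |w.2| * C) (𝓝 w) (𝓝 0) := by
      have : Continuous fun w : ℂ × ℝ => |w.2| * C := by fun_prop
      simpa [hw] using this.tendsto w
    have : Tendsto (fun w : ℂ × ℝ => (w.2 : ℂ) * (G (w.1 / w.2) - w.1 / w.2)) (𝓝 w) (𝓝 0) := by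
      refine squeeze_zero_norm (fun v => ?_) h0
      rw [norm_mul, Complex.norm_real, Real.norm_eq_abs]
      exact mul_le_mul_of_nonneg_left (hC _) (abs_nonneg _)
    simpa [ContinuousAt, hw] using this
  · have hw' : (w.2 : ℂ) ≠ 0 := by exact_mod_cast hw
    have h1 : ContinuousAt (fun w : ℂ × ℝ => w.1 / (w.2 : ℂ)) w :=
      continuousAt_fst.div (Complex.continuous_ofReal.continuousAt.comp continuousAt_snd) hw'
    have h2 : ContinuousAt (fun w : ℂ × ℝ => G (w.1 / (w.2 : ℂ))) w :=
      G.continuous.continuousAt.comp h1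
    exact (Complex.continuous_ofReal.continuousAt.comp continuousAt_snd).mul (h2.sub h1)

/-- A fixed point free plane homeomorphism with bounded displacement has no point of period two. -/
theorem HasBoundedDisplacement.apply_apply_ne {G : ℂ ≃ₜ ℂ} (hG : HasBoundedDisplacement G)
    (hfix : ∀ z, G z ≠ z) (z₀ : ℂ) : G (G z₀) ≠ z₀ := by
  intro hz
  let K : ℂ × ℝ → ℂ := fun w => w.1 + w.2 * (G (w.1 / w.2) - w.1 / w.2)
  have hK : Continuous K := hG.continuous_alexander
  have hinj : ∀ x y t, K (x, t) = K (y, t) → x = y := fun x y t h => by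
    by_cases ht : t = 0
    · simpa [K, ht] using h
    · have ht' : (t : ℂ) ≠ 0 := by exact_mod_cast ht
      have hh : ∀ x, K (x, t) = t * G (x / t) := fun x => by
        simp only [K]
        field_simp
        ring
      rw [hh, hh] at h
      have h2 := G.injective (mul_left_cancel₀ ht' h)
      rwa [div_left_inj' ht'] at h2
  let Φ : ℂ × ℝ → ℂ := fun w => K (G w.1, w.2) - K w
  have hΦ : Continuous Φ := (hK.comp ((G.continuous.comp continuous_fst).prodMk
    continuous_snd)).sub hK
  have hΦ0 : ∀ w, Φ w ≠ 0 := fun w h => hfix w.1 (hinj _ _ _ (sub_eq_zero.1 h))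
  obtain ⟨Θ, hΘ, hΘe⟩ := exists_continuous_log Φ hΦ hΦ0
  have hc1 := eq_of_exp_eq_const (f := fun x => Θ (x, 1) - Θ (G x, 0)) (c := 1) (by fun_prop)
    (fun x => by
      rw [Complex.exp_sub, hΘe, hΘe, div_eq_one_iff_eq (hΦ0 _)]
      simp [Φ, K]) z₀ (G z₀)
  have he : ∀ t : ℝ, Complex.exp (Θ (G z₀, t) - Θ (z₀, t)) = -1 := fun t => by
    rw [Complex.exp_sub, hΘe, hΘe, div_eq_iff (hΦ0 _)]
    simp only [Φ, hz]
    ring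
  have hc2 := eq_of_exp_eq_const (f := fun t : ℝ => Θ (G z₀, t) - Θ (z₀, t)) (c := -1)
    (by fun_prop) he 1 0
  have h0 := he 0
  simp only [hz] at hc1 hc2
  have : Θ (G z₀, 0) - Θ (z₀, 0) = 0 := by linear_combination (-hc1 - hc2) / 2
  rw [this, Complex.exp_zero] at h0
  norm_num at h0

/-- A point can be pushed to a nearby one by a homeomorphism supported in a ball. -/
theorem exists_homeomorph_ball {a b : ℂ} {r : ℝ} (h : ‖b - a‖ < r) :
    ∃ f : ℂ ≃ₜ ℂ, HasBoundedDisplacement f ∧ (∀ z, z ∉ Metric.ball a r → f z = z) ∧ f a = b := by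
  have hr : 0 < r := (norm_nonneg _).trans_lt h
  let f : ℂ → ℂ := fun z => z + (max 0 (1 - ‖z - a‖ / r) : ℝ) • (b - a)
  have hmax : ∀ x y : ℂ, |max 0 (1 - ‖x - a‖ / r) - max 0 (1 - ‖y - a‖ / r)| ≤ ‖x - y‖ / r :=
    fun x y => by
      rw [max_comm 0, max_comm 0]
      refine (abs_max_sub_max_le_abs _ _ (0 : ℝ)).trans ?_
      have e : (1 - ‖x - a‖ / r) - (1 - ‖y - a‖ / r) = (‖y - a‖ - ‖x - a‖) / r := by ring
      rw [e, abs_div, abs_of_pos hr]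
      refine div_le_div_of_nonneg_right ?_ hr.le
      have h2 := abs_norm_sub_norm_le (y - a) (x - a)
      rwa [sub_sub_sub_cancel_right, norm_sub_rev y x] at h2
  let c : NNReal := ⟨‖b - a‖ / r, by positivity⟩
  have hf : ApproximatesLinearOn f ((ContinuousLinearEquiv.refl ℝ ℂ : ℂ ≃L[ℝ] ℂ) : ℂ →L[ℝ] ℂ)
      Set.univ c := by
    intro x _ y _
    have : f x - f y - ((ContinuousLinearEquiv.refl ℝ ℂ : ℂ ≃L[ℝ] ℂ) : ℂ →L[ℝ] ℂ) (x - y) =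
        (max 0 (1 - ‖x - a‖ / r) - max 0 (1 - ‖y - a‖ / r)) • (b - a) := by
      simp [f]
      ring
    rw [this, norm_smul, Real.norm_eq_abs]
    refine (mul_le_mul_of_nonneg_right (hmax x y) (norm_nonneg _)).trans (le_of_eq ?_)
    change _ = ‖b - a‖ / r * _
    ring
  refine ⟨hf.toHomeomorph f (Or.inr ?_), ⟨‖b - a‖, fun z => ?_⟩, fun z hz => ?_, ?_⟩
  · have hn : ‖(((ContinuousLinearEquiv.refl ℝ ℂ).symm : ℂ ≃L[ℝ] ℂ) : ℂ →L[ℝ] ℂ)‖₊ = 1 := by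
      have : (((ContinuousLinearEquiv.refl ℝ ℂ).symm : ℂ ≃L[ℝ] ℂ) : ℂ →L[ℝ] ℂ) =
        ContinuousLinearMap.id ℝ ℂ := rfl
      rw [this]
      exact ContinuousLinearMap.nnnorm_id
    rw [hn, inv_one]
    exact (div_lt_one hr).2 h
  · change ‖f z - z‖ ≤ _
    simp only [f, add_sub_cancel_left, norm_smul, Real.norm_eq_abs]
    refine mul_le_of_le_one_left (norm_nonneg _) ?_
    rw [abs_of_nonneg (le_max_left _ _)]
    refine max_le zero_le_one ?_
    have : 0 ≤ ‖z - a‖ / r := by positivity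
    linarith
  · change f z = z
    have h1 : r ≤ ‖z - a‖ := by simpa [dist_eq_norm] using hz
    have h2 : 1 ≤ ‖z - a‖ / r := (one_le_div hr).2 h1
    simp only [f, max_eq_left (sub_nonpos.2 h2), zero_smul, add_zero]
  · change f a = b
    simp [f]

/-- Any two points of a connected open set can be exchanged by a homeomorphism supported in it. -/
theorem exists_homeomorph_of_isPreconnected {U : Set ℂ} (hU : IsOpen U) (hc : IsPreconnected U)
    {a b : ℂ} (ha : a ∈ U) (hb : b ∈ U) :
    ∃ f : ℂ ≃ₜ ℂ, HasBoundedDisplacement f ∧ (∀ z, z ∉ U → f z = z) ∧ f a = b := by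
  refine hc.induction₂
    (fun a b => ∃ f : ℂ ≃ₜ ℂ, HasBoundedDisplacement f ∧ (∀ z, z ∉ U → f z = z) ∧ f a = b)
    (fun x hx => ?_) ?_ ?_ ha hb
  · obtain ⟨r, hr, hrU⟩ := Metric.isOpen_iff.1 hU x hx
    refine mem_nhdsWithin_of_mem_nhds ?_
    filter_upwards [Metric.ball_mem_nhds x hr] with y hy
    obtain ⟨f, h1, h2, h3⟩ := exists_homeomorph_ball (a := x) (b := y) (r := r)
      (by rwa [← dist_eq_norm])
    exact ⟨f, h1, fun z hz => h2 z fun h => hz (hrU h), h3⟩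
  · rintro x y z - - - ⟨f, h1, h2, h3⟩ ⟨g, k1, k2, k3⟩
    refine ⟨f.trans g, h1.trans k1, fun w hw => ?_, ?_⟩
    · simp [h2 w hw, k2 w hw]
    · simp [h3, k3]
  · rintro x y - - ⟨f, h1, h2, h3⟩
    refine ⟨f.symm, h1.symm, fun w hw => ?_, ?_⟩
    · rw [f.symm_apply_eq, h2 w hw]
    · rw [f.symm_apply_eq, h3]

theorem apply_mem_of_eq_off {U : Set ℂ} {f : ℂ ≃ₜ ℂ} (hf : ∀ z, z ∉ U → f z = z) {z : ℂ}
    (hz : z ∈ U) : f z ∈ U := by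
  by_contra h
  exact h (by rwa [f.injective (hf _ h)])

/-- Simultaneous pushing of points inside pairwise disjoint connected open sets. -/
theorem exists_homeomorph_of_pairwise_disjoint {ι : Type*} {U : ι → Set ℂ} (hU : ∀ i, IsOpen (U i))
    (hc : ∀ i, IsPreconnected (U i)) (hd : Pairwise (Function.onFun Disjoint U)) {a b : ι → ℂ}
    (ha : ∀ i, a i ∈ U i) (hb : ∀ i, b i ∈ U i) (t : Finset ι) :
    ∃ f : ℂ ≃ₜ ℂ, HasBoundedDisplacement f ∧ (∀ z, f z = z ∨ ∃ i ∈ t, z ∈ U i ∧ f z ∈ U i) ∧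
      ∀ i ∈ t, f (a i) = b i := by
  classical
  induction t using Finset.induction_on with
  | empty => exact ⟨Homeomorph.refl ℂ, .refl, fun z => Or.inl rfl, by simp⟩
  | insert j t hj ih =>
    obtain ⟨f, h1, h2, h3⟩ := ih
    obtain ⟨g, k1, k2, k3⟩ := exists_homeomorph_of_isPreconnected (hU j) (hc j) (ha j) (hb j)
    have hdis : ∀ i ∈ t, ∀ z ∈ U i, z ∉ U j := fun i hi z hz hz' =>
      Set.disjoint_left.1 (hd (fun h : i = j => hj (h ▸ hi))) hz hz'
    refine ⟨f.trans g, h1.trans k1, fun z => ?_, fun i hi => ?_⟩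
    · rcases h2 z with h | ⟨i, hi, hz, hfz⟩
      · by_cases hz : z ∈ U j
        · right
          refine ⟨j, Finset.mem_insert_self _ _, hz, ?_⟩
          simpa [h] using apply_mem_of_eq_off k2 hz
        · left
          simp [h, k2 z hz]
      · right
        refine ⟨i, Finset.mem_insert_of_mem hi, hz, ?_⟩
        simpa [k2 _ (hdis i hi _ hfz)] using hfz
    · rcases Finset.mem_insert.1 hi with rfl | hi
      · rcases h2 (a i) with h | ⟨j, hj', hz, -⟩
        · simp [h, k3]
        · exact absurd (ha i) (hdis j hj' _ hz)
      · simp [h3 i hi, k2 _ (hdis i hi _ (hb i))]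

theorem exists_thickening_separated {G : ℂ → ℂ} (hG : Continuous G) {K K' : Set ℂ}
    (hK : IsCompact K) (hK' : IsCompact K') (h : ∀ x ∈ K, G x ∉ K') :
    ∃ r > 0, ∀ x ∈ Metric.thickening r K, G x ∉ Metric.thickening r K' := by
  have hd : Disjoint (G '' K) K' := by
    rw [Set.disjoint_left]
    rintro _ ⟨x, hx, rfl⟩
    exact h x hx
  obtain ⟨δ, hδ, hdis⟩ := hd.exists_thickenings (hK.image hG) hK'.isClosed
  obtain ⟨ε, hε, hsub⟩ := hK.exists_thickening_subset_open
    (Metric.isOpen_thickening.preimage hG : IsOpen (G ⁻¹' Metric.thickening δ (G '' K)))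
    (fun x hx => Metric.self_subset_thickening hδ _ (Set.mem_image_of_mem G hx))
  refine ⟨min δ ε, lt_min hδ hε, fun x hx hx' => ?_⟩
  exact Set.disjoint_left.1 hdis (hsub (Metric.thickening_mono (min_le_right _ _) _ hx))
    (Metric.thickening_mono (min_le_left _ _) _ hx')

theorem exists_thickening_avoiding {K E : Set ℂ} (hK : IsCompact K) (hE : E.Finite)
    (h : ∀ x ∈ E, x ∉ K) : ∃ r > 0, ∀ x ∈ E, x ∉ Metric.thickening r K := by
  obtain ⟨r, hr, h'⟩ := exists_thickening_separated continuous_id hE.isCompact hK h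
  exact ⟨r, hr, fun x hx => h' x (Metric.self_subset_thickening hr _ hx)⟩

theorem IsPreconnected.thickening {K : Set ℂ} (hK : IsPreconnected K) (r : ℝ) :
    IsPreconnected (Metric.thickening r K) := by
  rw [← add_ball_zero r K, ← Set.add_image_prod]
  exact (hK.prod (convex_ball (0 : ℂ) r).isPreconnected).image _ continuous_add.continuousOn

/-- A free connected open set is disjoint from its second iterate. -/
theorem apply_apply_notMem_of_free {G : ℂ ≃ₜ ℂ} (hG : HasBoundedDisplacement G)
    (hfix : ∀ z, G z ≠ z) {U : Set ℂ} (hU : IsOpen U) (hc : IsPreconnected U)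
    (hfree : ∀ z ∈ U, G z ∉ U) : ∀ z ∈ U, G (G z) ∉ U := by
  intro z hz hz2
  obtain ⟨h, hb, hoff, hz'⟩ := exists_homeomorph_of_isPreconnected hU hc hz2 hz
  refine (hG.trans hb).apply_apply_ne (fun w hw => ?_) z ?_
  · by_cases hw' : G w ∈ U
    · have := apply_mem_of_eq_off hoff hw'
      rw [Homeomorph.trans_apply] at hw
      rw [hw] at this
      exact hfree w this hw'
    · rw [Homeomorph.trans_apply, hoff _ hw'] at hw
      exact hfix w hw
  · rw [Homeomorph.trans_apply, Homeomorph.trans_apply, hoff _ (hfree z hz), hz']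

theorem apply_apply_notMem_of_free_isCompact {G : ℂ ≃ₜ ℂ} (hG : HasBoundedDisplacement G)
    (hfix : ∀ z, G z ≠ z) {K : Set ℂ} (hK : IsCompact K) (hc : IsPreconnected K)
    (hfree : ∀ z ∈ K, G z ∉ K) : ∀ z ∈ K, G (G z) ∉ K := by
  obtain ⟨r, hr, h⟩ := exists_thickening_separated G.continuous hK hK hfree
  exact fun z hz hz2 => apply_apply_notMem_of_free hG hfix Metric.isOpen_thickening
    (hc.thickening r) h z (Metric.self_subset_thickening hr _ hz)
    (Metric.self_subset_thickening hr _ hz2)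

/-- If pushing points in three suitably separated connected open sets shortcuts a periodic orbit,
then some fixed point free homeomorphism has a shorter periodic orbit. -/
theorem exists_shorter_periodic {G : ℂ ≃ₜ ℂ} (hG : HasBoundedDisplacement G)
    (hfix : ∀ z, G z ≠ z) {U B : Set ℂ} (hU : IsOpen U) (hUc : IsPreconnected U)
    (hB : IsOpen B) (hBc : IsPreconnected B)
    (hUU : ∀ z ∈ U, G z ∉ U) (hUU2 : ∀ z ∈ U, G (G z) ∉ U) (hBB : ∀ z ∈ B, G z ∉ B)
    (hBU : ∀ z ∈ B, G z ∉ U) (hUB : ∀ z ∈ U, G (G z) ∉ B)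
    {n : ℕ} (hn : 3 ≤ n) {y : ℕ → ℂ} (hy : ∀ j < n, y (j + 1) = G (y j)) (hyn : y n = y 0)
    (hy0 : y 0 ∈ U) (hyU : ∀ j, 1 ≤ j → j < n → y j ∉ U) (hyB : ∀ j, 2 ≤ j → j < n → y j ∉ B)
    {u v : ℂ} (hu : u ∈ U) (huB : u ∈ B) (hv : v ∈ U) (hvB : G v ∈ B) :
    ∃ g : ℂ ≃ₜ ℂ, HasBoundedDisplacement g ∧ (∀ z, g z ≠ z) ∧ ∃ z, g^[n - 1] z = z := by
  have hGU : IsOpen (G '' U) := G.isOpenMap _ hU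
  have hGUc : IsPreconnected (G '' U) := hUc.image _ G.continuous.continuousOn
  obtain ⟨f₁, b₁, o₁, e₁⟩ := exists_homeomorph_of_isPreconnected hU hUc hy0 hu
  obtain ⟨f₂, b₂, o₂, e₂⟩ := exists_homeomorph_of_isPreconnected hB hBc huB hvB
  obtain ⟨f₃, b₃, o₃, e₃⟩ := exists_homeomorph_of_isPreconnected hGU hGUc
    (Set.mem_image_of_mem G hv) (Set.mem_image_of_mem G hy0)
  have hmove : ∀ {S : Set ℂ} {f : ℂ ≃ₜ ℂ}, (∀ z, z ∉ S → f z = z) → ∀ z,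
      f z = z ∨ z ∈ S ∧ f z ∈ S := fun {S f} h z => by
    by_cases hz : z ∈ S
    · exact Or.inr ⟨hz, apply_mem_of_eq_off h hz⟩
    · exact Or.inl (h z hz)
  have hGUGU : ∀ z, z ∈ G '' U → G z ∉ G '' U := by
    rintro _ ⟨w, hw, rfl⟩ ⟨w', hw', h⟩
    exact hUU w hw (G.injective h ▸ hw')
  have hGU_U : ∀ z, z ∈ G '' U → G z ∉ U := by
    rintro _ ⟨w, hw, rfl⟩
    exact hUU2 w hw
  have hGU_B : ∀ z, z ∈ G '' U → G z ∉ B := by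
    rintro _ ⟨w, hw, rfl⟩
    exact hUB w hw
  refine ⟨((G.trans f₁).trans f₂).trans f₃, ((hG.trans b₁).trans b₂).trans b₃, fun z hz => ?_,
    y 1, ?_⟩
  · simp only [Homeomorph.trans_apply] at hz
    have h₁ := hmove o₁ (G z)
    have h₂ := hmove o₂ (f₁ (G z))
    have h₃ := hmove o₃ (f₂ (f₁ (G z)))
    rw [hz] at h₃
    rcases h₁ with h₁ | ⟨h₁, h₁'⟩
    · rw [h₁] at h₂ h₃
      rcases h₂ with h₂ | ⟨h₂, h₂'⟩
      · rw [h₂] at h₃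
        rcases h₃ with h₃ | ⟨h₃, h₃'⟩
        · exact hfix z h₃.symm
        · exact hGUGU _ h₃' h₃
      · rcases h₃ with h₃ | ⟨h₃, h₃'⟩
        · exact hBB z (h₃ ▸ h₂') h₂
        · exact hGU_B z h₃' h₂
    · rcases h₂ with h₂ | ⟨h₂, h₂'⟩
      · rw [h₂] at h₃
        rcases h₃ with h₃ | ⟨h₃, h₃'⟩
        · exact hUU z (h₃ ▸ h₁') h₁
        · exact hGU_U z h₃' h₁
      · rcases h₃ with h₃ | ⟨h₃, h₃'⟩
        · exact hBU z (h₃ ▸ h₂') h₁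
        · exact hGU_U z h₃' h₁
  · have hstep : ∀ j, 1 ≤ j → j + 1 < n →
        (((G.trans f₁).trans f₂).trans f₃) (y j) = y (j + 1) := fun j hj hj' => by
      simp only [Homeomorph.trans_apply]
      rw [← hy j (by omega), o₁ _ (hyU _ (by omega) hj'), o₂ _ (hyB _ (by omega) hj'), o₃]
      rintro ⟨w, hw, h⟩
      rw [hy j (by omega)] at h
      exact hyU j hj (by omega) (G.injective h ▸ hw)
    have hiter : ∀ j, j + 1 < n →
        (((G.trans f₁).trans f₂).trans f₃)^[j] (y 1) = y (j + 1) := fun j => by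
      induction j with
      | zero => intro _; rfl
      | succ j ih =>
        intro h
        rw [Function.iterate_succ_apply', ih (by omega), hstep _ (by omega) h]
    obtain ⟨k, rfl⟩ : ∃ k, n = k + 3 := ⟨n - 3, by omega⟩
    change (((G.trans f₁).trans f₂).trans f₃)^[k + 2] (y 1) = y 1
    rw [Function.iterate_succ_apply', hiter _ (by omega)]
    simp only [Homeomorph.trans_apply]
    rw [← hy _ (by omega), hyn, e₁, e₂, e₃, ← hy 0 (by omega)]

/-- Along an arc from a point of a periodic orbit that first meets its image at its endpoint, the
orbit can be shortened. -/
theorem exists_shorter_periodic_of_arc {G : ℂ ≃ₜ ℂ} (hG : HasBoundedDisplacement G)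
    (hfix : ∀ z, G z ≠ z) {n : ℕ} (hn : 3 ≤ n) {y : ℕ → ℂ}
    (hy : ∀ j < n, y (j + 1) = G (y j)) (hyn : y n = y 0)
    {c : ℝ → ℂ} (hc : Continuous c) {s t : ℝ} (hs : 0 ≤ s) (hst : s < t) (hc0 : c 0 = y 0)
    (hct : c t = G (c s))
    (hfree : ∀ a ∈ Set.Ico 0 t, ∀ b ∈ Set.Ico 0 t, G (c a) ≠ c b)
    (hyc : ∀ u ∈ Set.Icc 0 t, ∀ j, 2 ≤ j → j < n → c u ≠ y j)
    (hy1 : ∀ u ∈ Set.Ico 0 t, c u ≠ y 1) :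
    ∃ g : ℂ ≃ₜ ℂ, HasBoundedDisplacement g ∧ (∀ z, g z ≠ z) ∧ ∃ z, g^[n - 1] z = z := by
  have hKc : ∀ a, IsCompact (c '' Set.Icc 0 a) := fun a => isCompact_Icc.image hc
  have hKp : ∀ a, IsPreconnected (c '' Set.Icc 0 a) := fun a =>
    isPreconnected_Icc.image _ hc.continuousOn
  have hfreeK : ∀ a < t, ∀ z ∈ c '' Set.Icc 0 a, G z ∉ c '' Set.Icc 0 a := by
    rintro a ha _ ⟨u, hu, rfl⟩ ⟨v, hv, h⟩
    exact hfree u ⟨hu.1, hu.2.trans_lt ha⟩ v ⟨hv.1, hv.2.trans_lt ha⟩ h.symm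
  have hfree2 : ∀ a ∈ Set.Ico 0 t, ∀ b ∈ Set.Ico 0 t, G (G (c a)) ≠ c b := by
    intro a ha b hb h
    exact apply_apply_notMem_of_free_isCompact hG hfix (hKc (max a b)) (hKp _)
      (hfreeK _ (max_lt ha.2 hb.2)) (c a) ⟨a, ⟨ha.1, le_max_left _ _⟩, rfl⟩
      ⟨b, ⟨hb.1, le_max_right _ _⟩, h.symm⟩
  have ht0 : 0 ≤ t := hs.trans hst.le
  have hs' : s ∈ Set.Ico 0 t := ⟨hs, hst⟩
  have hGct : ∀ z ∈ ({c t} : Set ℂ), G z ∉ c '' Set.Icc 0 t := by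
    rintro _ rfl ⟨b, hb, h⟩
    rcases hb.2.lt_or_eq with hbt | rfl
    · exact hfree2 s hs' b ⟨hb.1, hbt⟩ (by rw [← hct, h])
    · exact hfix _ h.symm
  have hG2ct : ∀ z ∈ c '' Set.Icc 0 t, (G ∘ G) z ∉ ({c t} : Set ℂ) := by
    rintro _ ⟨a, ha, rfl⟩ h
    have h' : G (c a) = c s := G.injective (by rw [← hct]; exact h)
    rcases ha.2.lt_or_eq with hat | rfl
    · exact hfree a ⟨ha.1, hat⟩ s hs' h'
    · exact hGct _ rfl ⟨s, ⟨hs, hst.le⟩, h'.symm⟩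
  have hfinE : ∀ k, (y '' {j | k ≤ j ∧ j < n}).Finite := fun k =>
    ((Set.finite_lt_nat n).subset fun j hj => hj.2).image y
  obtain ⟨r₁, hr₁, H₁⟩ := exists_thickening_separated G.continuous isCompact_singleton (hKc t) hGct
  obtain ⟨r₂, hr₂, H₂⟩ := exists_thickening_separated (G.continuous.comp G.continuous) (hKc t)
    isCompact_singleton hG2ct
  obtain ⟨r₃, hr₃, H₃⟩ := exists_thickening_avoiding (hKc t) (hfinE 2) (by
    rintro _ ⟨j, hj, rfl⟩ ⟨u, hu, h⟩
    exact hyc u hu j hj.1 hj.2 h)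
  obtain ⟨r, hr, hrr₁, hrr₂, hrr₃⟩ : ∃ r > 0, r ≤ r₁ ∧ r ≤ r₂ ∧ r ≤ r₃ :=
    ⟨min r₁ (min r₂ r₃), by positivity, min_le_left _ _,
      (min_le_right _ _).trans (min_le_left _ _), (min_le_right _ _).trans (min_le_right _ _)⟩
  have hctK : ({c t} : Set ℂ) ⊆ c '' Set.Icc 0 t := by
    rintro _ rfl
    exact ⟨t, ⟨ht0, le_rfl⟩, rfl⟩
  set B : Set ℂ := Metric.thickening r {c t} with hBdef
  have hBo : IsOpen B := Metric.isOpen_thickening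
  have hBt : c t ∈ B := Metric.self_subset_thickening hr _ rfl
  obtain ⟨t', ht', hst', hBt'⟩ : ∃ t' < t, s ≤ t' ∧ c t' ∈ B := by
    have h1 : ∀ᶠ x in 𝓝[<] t, c x ∈ B :=
      (hc.tendsto t).mono_left nhdsWithin_le_nhds |>.eventually (hBo.mem_nhds hBt)
    have h2 : ∀ᶠ x in 𝓝[<] t, x ∈ Set.Ioo s t := Ioo_mem_nhdsLT hst
    obtain ⟨x, hx1, hx2⟩ := (h1.and h2).exists
    exact ⟨x, hx2.2, hx2.1.le, hx1⟩
  have hKK : c '' Set.Icc 0 t' ⊆ c '' Set.Icc 0 t :=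
    Set.image_mono (Set.Icc_subset_Icc_right ht'.le)
  obtain ⟨r₄, hr₄, H₄⟩ := exists_thickening_separated G.continuous (hKc t') (hKc t')
    (hfreeK t' ht')
  obtain ⟨r₅, hr₅, H₅⟩ := exists_thickening_avoiding (hKc t') (hfinE 1) (by
    rintro _ ⟨j, hj, rfl⟩ ⟨u, hu, h⟩
    rcases hj.1.eq_or_lt with rfl | hj1
    · exact hy1 u ⟨hu.1, hu.2.trans_lt ht'⟩ h
    · exact hyc u ⟨hu.1, hu.2.trans ht'.le⟩ j hj1 hj.2 h)
  obtain ⟨ρ, hρ, hρr, hρ₄, hρ₅⟩ : ∃ ρ > 0, ρ ≤ r ∧ ρ ≤ r₄ ∧ ρ ≤ r₅ :=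
    ⟨min r (min r₄ r₅), by positivity, min_le_left _ _,
      (min_le_right _ _).trans (min_le_left _ _), (min_le_right _ _).trans (min_le_right _ _)⟩
  set U : Set ℂ := Metric.thickening ρ (c '' Set.Icc 0 t') with hUdef
  have hUK : ∀ a, 0 ≤ a → a ≤ t' → c a ∈ U := fun a h0 h1 =>
    Metric.self_subset_thickening hρ _ ⟨a, ⟨h0, h1⟩, rfl⟩
  have hUsub : ∀ R, r ≤ R → U ⊆ Metric.thickening R (c '' Set.Icc 0 t) := fun R hR =>
    (Metric.thickening_subset_of_subset _ hKK).trans (Metric.thickening_mono (hρr.trans hR) _)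
  have hBsub : ∀ R, r ≤ R → B ⊆ Metric.thickening R {c t} := fun R hR =>
    Metric.thickening_mono hR _
  have hUU : ∀ z ∈ U, G z ∉ U := fun z hz hz' =>
    H₄ z (Metric.thickening_mono hρ₄ _ hz) (Metric.thickening_mono hρ₄ _ hz')
  have hUp : IsPreconnected U := (hKp t').thickening ρ
  refine exists_shorter_periodic hG hfix Metric.isOpen_thickening hUp hBo
    (isPreconnected_singleton.thickening r) hUU
    (apply_apply_notMem_of_free hG hfix Metric.isOpen_thickening hUp hUU)
    (fun z hz hz' => H₁ z (hBsub _ hrr₁ hz)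
      (Metric.thickening_subset_of_subset _ hctK (hBsub _ hrr₁ hz')))
    (fun z hz hz' => H₁ z (hBsub _ hrr₁ hz) (hUsub _ hrr₁ hz'))
    (fun z hz hz' => H₂ z (hUsub _ hrr₂ hz) (hBsub _ hrr₂ hz')) hn hy hyn
    (hc0 ▸ hUK 0 le_rfl (hs.trans hst'))
    (fun j h1 h2 h => H₅ _ ⟨j, ⟨h1, h2⟩, rfl⟩ (Metric.thickening_mono hρ₅ _ h))
    (fun j h1 h2 h => H₃ _ ⟨j, ⟨h1, h2⟩, rfl⟩
      (Metric.thickening_subset_of_subset _ hctK (hBsub _ hrr₃ h)))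
    (hUK t' (hs.trans hst') le_rfl) hBt' (hUK s hs hst') (hct ▸ hBt)

/-- **Brouwer's lemma**: a fixed point free plane homeomorphism with bounded displacement has no
periodic points. -/
theorem HasBoundedDisplacement.iterate_ne {n : ℕ} (hn : 1 ≤ n) {G : ℂ ≃ₜ ℂ}
    (hG : HasBoundedDisplacement G) (hfix : ∀ z, G z ≠ z) (x : ℂ) : G^[n] x ≠ x := by
  induction n using Nat.strong_induction_on generalizing G x with
  | _ n ih =>
  intro hx
  rcases (by omega : n = 1 ∨ n = 2 ∨ 3 ≤ n) with rfl | rfl | hn3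
  · exact hfix x hx
  · exact hG.apply_apply_ne hfix x hx
  suffices h : ∃ g : ℂ ≃ₜ ℂ, HasBoundedDisplacement g ∧ (∀ z, g z ≠ z) ∧ ∃ z, g^[n - 1] z = z by
    obtain ⟨g, h1, h2, z, hz⟩ := h
    exact ih (n - 1) (by omega) (by omega) h1 h2 z hz
  have hne : ∀ i j, i < j → j < n → G^[i] x ≠ G^[j] x := fun i j hij hj h => by
    refine ih (j - i) (by omega) (by omega) hG hfix (G^[i] x) ?_
    rw [← Function.iterate_add_apply, Nat.sub_add_cancel hij.le, h]
  set E : Set ℂ := (fun j => G^[j] x) '' {j | 2 ≤ j ∧ j < n} with hE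
  have hEfin : E.Finite := ((Set.finite_lt_nat n).subset fun j hj => hj.2).image _
  have hpc : IsPathConnected Eᶜ := hEfin.countable.isPathConnected_compl_of_one_lt_rank (by
    rw [Complex.rank_real_complex]; norm_num)
  have hxE : ∀ i < 2, G^[i] x ∈ Eᶜ := by
    rintro i hi ⟨j, hj, h⟩
    exact hne i j (by have := hj.1; omega) hj.2 h.symm
  obtain ⟨P, hP⟩ := hpc.joinedIn _ (hxE 0 (by norm_num)) _ (hxE 1 (by norm_num))
  let c : ℝ → ℂ := P.extend
  have hc : Continuous c := P.continuous_extend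
  have hcE : ∀ t, c t ∉ E := fun t => hP _
  have hc0 : c 0 = x := P.extend_zero
  have hc1 : c 1 = G x := P.extend_one
  let D : Set (ℝ × ℝ) := {w | w.1 ∈ Set.Icc (0 : ℝ) 1 ∧ w.2 ∈ Set.Icc (0 : ℝ) 1 ∧ w.2 ≤ w.1 ∧
    (c w.1 = G (c w.2) ∨ c w.2 = G (c w.1))}
  have hD : IsCompact D := by
    refine (isCompact_Icc.prod isCompact_Icc : IsCompact
      (Set.Icc (0 : ℝ) 1 ×ˢ Set.Icc (0 : ℝ) 1)).of_isClosed_subset ?_ fun w hw => ⟨hw.1, hw.2.1⟩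
    have hG' := G.continuous
    refine (isClosed_Icc.preimage continuous_fst).inter ((isClosed_Icc.preimage
      continuous_snd).inter ((isClosed_le continuous_snd continuous_fst).inter
      (IsClosed.union ?_ ?_)))
    · exact isClosed_eq (by fun_prop) (by fun_prop)
    · exact isClosed_eq (by fun_prop) (by fun_prop)
  have hDne : (Prod.fst '' D).Nonempty :=
    ⟨1, (1, 0), ⟨by simp, by simp, by simp, Or.inl (by simp [hc0, hc1])⟩, rfl⟩
  obtain ⟨_, ⟨⟨t, s⟩, ⟨htI, hsI, hst, hor⟩, rfl⟩, hmin⟩ :=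
    (hD.image continuous_fst).exists_isLeast hDne
  simp only at htI hsI hst hor hmin
  have hst : s < t := by
    refine lt_of_le_of_ne hst ?_
    rintro rfl
    rcases hor with h | h <;> exact hfix _ h.symm
  have hgood : ∀ u v, 0 ≤ u → 0 ≤ v → v ≤ u → (c u = G (c v) ∨ c v = G (c u)) → t ≤ u := by
    intro u v hu hv hvu h
    rcases le_total u 1 with hu1 | hu1
    · exact hmin ⟨(u, v), ⟨⟨hu, hu1⟩, ⟨hv, hvu.trans hu1⟩, hvu, h⟩, rfl⟩
    · exact htI.2.trans hu1
  have hfree : ∀ a ∈ Set.Ico 0 t, ∀ b ∈ Set.Ico 0 t, G (c a) ≠ c b := by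
    intro a ha b hb h
    rcases le_total a b with hab | hab
    · exact absurd (hgood b a hb.1 ha.1 hab (Or.inl h.symm)) (not_le.2 hb.2)
    · exact absurd (hgood a b ha.1 hb.1 hab (Or.inr h.symm)) (not_le.2 ha.2)
  rcases hor with hor | hor
  · refine exists_shorter_periodic_of_arc hG hfix hn3 (y := fun j => G^[j] x)
      (fun j _ => Function.iterate_succ_apply' _ _ _) hx hc hsI.1 hst hc0 hor hfree
      (fun u _ j h1 h2 h => hcE u ⟨j, ⟨h1, h2⟩, h.symm⟩) (fun u hu h => ?_)
    exact absurd (hgood u 0 hu.1 le_rfl hu.1 (Or.inl (by rw [hc0, h]; rfl))) (not_le.2 hu.2)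
  · refine exists_shorter_periodic_of_arc hG.symm (fun z hz => hfix z ?_) hn3
      (y := fun j => G^[n - j] x) (fun j hj => ?_) (by simp [hx]) hc hsI.1 hst ?_ ?_ ?_ ?_ ?_
    · conv_lhs => rw [← hz]
      exact G.apply_symm_apply z
    · rw [eq_comm, G.symm_apply_eq, ← Function.iterate_succ_apply' (⇑G)]
      congr 1
      omega
    · rw [hc0]
      exact hx.symm
    · rw [eq_comm, G.symm_apply_eq]
      exact hor
    · intro a ha b hb h
      rw [G.symm_apply_eq] at h
      exact hfree b hb a ha h.symm
    · intro u hu j h1 h2 h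
      rcases (by omega : n - j = 1 ∨ 2 ≤ n - j) with h3 | h3
      · rw [h3] at h
        have hut := le_antisymm hu.2 (hgood u 0 hu.1 le_rfl hu.1 (Or.inl (by rw [hc0, h]; rfl)))
        rw [hut] at h
        refine hcE s ⟨2, ⟨le_rfl, by omega⟩, ?_⟩
        rw [hor, h]
        rfl
      · exact hcE u ⟨n - j, ⟨h3, by omega⟩, h.symm⟩
    · intro u hu h
      exact hcE u ⟨n - 1, ⟨by omega, by omega⟩, h.symm⟩

theorem exists_chain_of_transGen {α : Type*} {R : α → α → Prop} {a b : α}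
    (h : Relation.TransGen R a b) :
    ∃ (n : ℕ) (f : ℕ → α), 1 ≤ n ∧ f 0 = a ∧ f n = b ∧ ∀ j < n, R (f j) (f (j + 1)) := by
  induction h with
  | single h =>
    rename_i b
    refine ⟨1, fun k => if k = 0 then a else b, le_rfl, rfl, rfl, fun j hj => ?_⟩
    obtain rfl : j = 0 := by omega
    exact h
  | tail _ hbc ih =>
    rename_i b c _
    obtain ⟨n, f, hn, h0, h1, h2⟩ := ih
    refine ⟨n + 1, fun k => if k ≤ n then f k else c, by omega, ?_, ?_, fun j hj => ?_⟩
    · simp [h0]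
    · simp
    · rcases (by omega : j < n ∨ j = n) with h | rfl
      · simpa [h.le, Nat.succ_le_of_lt h] using h2 j h
      · simpa [h1] using hbc

/-- **Franks' lemma**: a fixed point free plane homeomorphism with bounded displacement admits no
cyclic chain of pairwise disjoint free connected open sets. -/
theorem not_transGen_of_free {G : ℂ ≃ₜ ℂ} (hG : HasBoundedDisplacement G)
    (hfix : ∀ z, G z ≠ z) {ι : Type*} {U : ι → Set ℂ} (hU : ∀ i, IsOpen (U i))
    (hc : ∀ i, IsPreconnected (U i)) (hd : Pairwise (Function.onFun Disjoint U))
    (hfree : ∀ i, ∀ z ∈ U i, G z ∉ U i) (i : ι) :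
    ¬ Relation.TransGen (fun i j => ∃ z ∈ U i, G z ∈ U j) i i := by
  classical
  intro hi
  have hex : ∃ n : ℕ, 1 ≤ n ∧ ∃ f : ℕ → ι, f n = f 0 ∧
      ∀ j < n, ∃ z ∈ U (f j), G z ∈ U (f (j + 1)) := by
    obtain ⟨n, f, h1, h2, h3, h4⟩ := exists_chain_of_transGen hi
    exact ⟨n, h1, f, h3.trans h2.symm, h4⟩
  obtain ⟨hn, f, hf0, hf⟩ := Nat.find_spec hex
  have hmin := fun m => Nat.find_min hex (m := m)
  set n := Nat.find hex
  have hinj : ∀ i j, i < j → j ≤ n → f i = f j → n ≤ j - i := by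
    intro i j hij hj h
    by_contra! hlt
    refine hmin _ hlt ⟨by omega, fun k => f (i + k), ?_, fun k hk => hf (i + k) (by omega)⟩
    simp only [Nat.add_sub_cancel' hij.le, add_zero, h]
  choose! z hz hz' using hf
  let w : ℕ → ℂ := fun j => if j = n then z 0 else z j
  have hw : ∀ j ≤ n, w j ∈ U (f j) := fun j hj => by
    by_cases h : j = n
    · simpa [w, h, hf0] using hz 0 (by omega)
    · simpa [w, h] using hz j (by omega)
  have hw' : ∀ j < n, G (w j) ∈ U (f (j + 1)) := fun j hj => by
    simpa [w, hj.ne] using hz' j hj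
  obtain ⟨h, hb, hmove, hpush⟩ := exists_homeomorph_of_pairwise_disjoint
    (U := fun i : Fin n => U (f (i + 1))) (fun _ => hU _) (fun _ => hc _) (fun i j hij => hd (by
      intro h
      rcases lt_or_gt_of_ne (Fin.val_ne_of_ne hij) with h1 | h1
      · have := hinj _ _ (by omega : (i : ℕ) + 1 < j + 1) j.2 h
        omega
      · have := hinj _ _ (by omega : (j : ℕ) + 1 < i + 1) i.2 h.symm
        omega))
    (a := fun i => G (w i)) (b := fun i => w (i + 1)) (fun i => hw' i i.2) (fun i => hw _ i.2)
    Finset.univ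
  have hit : ∀ j ≤ n, (G.trans h)^[j] (w 0) = w j := fun j => by
    induction j with
    | zero => intro _; rfl
    | succ j ih =>
      intro hj
      rw [Function.iterate_succ_apply', ih (by omega), Homeomorph.trans_apply]
      exact hpush ⟨j, hj⟩ (Finset.mem_univ _)
  refine (hG.trans hb).iterate_ne hn (fun p hp => ?_) (w 0) ?_
  · rw [Homeomorph.trans_apply] at hp
    rcases hmove (G p) with h1 | ⟨i, -, h1, h2⟩
    · exact hfix p (h1.symm.trans hp)
    · rw [hp] at h2
      exact hfree _ p h2 h1
  · rw [hit n le_rfl]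
    simp only [w, if_true]
    split_ifs <;> rfl

/-- The lattice `ℤ²` inside the plane. -/
def latticePoint : ℤ × ℤ →+ ℂ where
  toFun m := m.1 + m.2 * Complex.I
  map_zero' := by simp
  map_add' m n := by
    simp only [Prod.fst_add, Prod.snd_add]
    push_cast
    ring

theorem latticePoint_re (m : ℤ × ℤ) : (latticePoint m).re = m.1 := by simp [latticePoint]

theorem latticePoint_im (m : ℤ × ℤ) : (latticePoint m).im = m.2 := by simp [latticePoint]

/-- A lattice-periodic tiling of the plane by small closed tiles such that two tiles which meet
share an edge. -/
structure PlaneTiling where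
  /-- The closed tiles. -/
  tile : ℤ × ℤ → Set ℂ
  /-- The open tiles. -/
  core : ℤ × ℤ → Set ℂ
  /-- The center of a tile. -/
  center : ℤ × ℤ → ℂ
  /-- The action of the lattice on the indices of the tiles. -/
  shift : ℤ × ℤ →+ ℤ × ℤ
  isOpen_core : ∀ a, IsOpen (core a)
  convex_core : ∀ a, Convex ℝ (core a)
  center_mem_core : ∀ a, center a ∈ core a
  closure_core : ∀ a, closure (core a) = tile a
  eq_of_mem_core : ∀ a b z, z ∈ core a → z ∈ core b → a = b
  isCompact_tile : ∀ a, IsCompact (tile a)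
  exists_mem_tile : ∀ z, ∃ a, z ∈ tile a
  locallyFinite_tile : LocallyFinite tile
  joinedIn_center : ∀ a b, (tile a ∩ tile b).Nonempty →
    JoinedIn (interior (tile a ∪ tile b)) (center a) (center b)
  core_add_shift : ∀ a m z, z ∈ core (a + shift m) ↔ z - latticePoint m ∈ core a
  tile_add_shift : ∀ a m z, z ∈ tile (a + shift m) ↔ z - latticePoint m ∈ tile a
  center_add_shift : ∀ a m, center (a + shift m) = center a + latticePoint m
  exists_finset : ∃ K : Finset (ℤ × ℤ), ∀ a, ∃ m, a + shift m ∈ K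

theorem joinedIn_symmetric_brick {P Q : Set ℂ} {x y e h : ℝ} (hh : 0 < h)
    (he : e = h / 2 ∨ e = -(h / 2))
    (hP : ∀ z : ℂ, z.re ∈ Set.Icc x (x + h) → z.im ∈ Set.Icc y (y + h) → z ∈ P)
    (hQ : ∀ z : ℂ, z.re ∈ Set.Icc (x + e) (x + e + h) → z.im ∈ Set.Icc (y + h) (y + h + h) →
      z ∈ Q) :
    JoinedIn (interior (P ∪ Q)) ⟨x + h / 2, y + h / 2⟩ ⟨x + e + h / 2, y + h + h / 2⟩ := by
  refine JoinedIn.of_segment_subset ?_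
  rw [segment_eq_image']
  rintro _ ⟨s, ⟨hs0, hs1⟩, rfl⟩
  rw [mem_interior_iff_mem_nhds, Metric.mem_nhds_iff]
  refine ⟨h / 8, by positivity, fun w hw => ?_⟩
  rw [Metric.mem_ball, dist_eq_norm] at hw
  have h1 := (Complex.abs_re_le_norm _).trans_lt hw
  have h2 := (Complex.abs_im_le_norm _).trans_lt hw
  simp only [Complex.sub_re, Complex.add_re, Complex.smul_re, Complex.sub_im, Complex.add_im,
    Complex.smul_im, smul_eq_mul, abs_lt] at h1 h2
  have e2 : y + h + h / 2 - (y + h / 2) = h := by ring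
  have e1 : x + e + h / 2 - (x + h / 2) = e := by ring
  rw [e1] at h1
  rw [e2] at h2
  have hs : 0 ≤ s * h := by positivity
  have hs' : s * h ≤ h := by nlinarith
  rcases he with rfl | rfl
  · rcases le_total w.im (y + h) with h3 | h3
    · exact Or.inl (hP w ⟨by linarith, by linarith⟩ ⟨by linarith, by linarith⟩)
    · exact Or.inr (hQ w ⟨by linarith, by linarith⟩ ⟨by linarith, by linarith⟩)
  · rcases le_total w.im (y + h) with h3 | h3
    · exact Or.inl (hP w ⟨by linarith, by linarith⟩ ⟨by linarith, by linarith⟩)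
    · exact Or.inr (hQ w ⟨by linarith, by linarith⟩ ⟨by linarith, by linarith⟩)

theorem joinedIn_row_brick {P Q : Set ℂ} {x y h : ℝ} (hh : 0 < h)
    (hP : ∀ z : ℂ, z.re ∈ Set.Icc x (x + h) → z.im ∈ Set.Icc y (y + h) → z ∈ P)
    (hQ : ∀ z : ℂ, z.re ∈ Set.Icc (x + h) (x + h + h) → z.im ∈ Set.Icc y (y + h) → z ∈ Q) :
    JoinedIn (interior (P ∪ Q)) ⟨x + h / 2, y + h / 2⟩ ⟨x + h + h / 2, y + h / 2⟩ := by
  refine JoinedIn.of_segment_subset ?_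
  rw [segment_eq_image']
  rintro _ ⟨s, ⟨hs0, hs1⟩, rfl⟩
  rw [mem_interior_iff_mem_nhds, Metric.mem_nhds_iff]
  refine ⟨h / 8, by positivity, fun w hw => ?_⟩
  rw [Metric.mem_ball, dist_eq_norm] at hw
  have h1 := (Complex.abs_re_le_norm _).trans_lt hw
  have h2 := (Complex.abs_im_le_norm _).trans_lt hw
  simp only [Complex.sub_re, Complex.add_re, Complex.smul_re, Complex.sub_im, Complex.add_im,
    Complex.smul_im, smul_eq_mul, abs_lt] at h1 h2
  have e2 : y + h / 2 - (y + h / 2) = 0 := by ring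
  have e1 : x + h + h / 2 - (x + h / 2) = h := by ring
  rw [e1] at h1
  rw [e2] at h2
  have hs : 0 ≤ s * h := by positivity
  have hs' : s * h ≤ h := by nlinarith
  rcases le_total w.re (x + h) with h3 | h3
  · exact Or.inl (hP w ⟨by linarith, by linarith⟩ ⟨by linarith, by linarith⟩)
  · exact Or.inr (hQ w ⟨by linarith, by linarith⟩ ⟨by linarith, by linarith⟩)

/-- The brick with index `a` and side length `h`. -/
def brickTile (h : ℝ) (a : ℤ × ℤ) : Set ℂ :=
  Set.Icc ((a.1 + a.2 / 2) * h) ((a.1 + a.2 / 2) * h + h) ×ℂ Set.Icc (a.2 * h) (a.2 * h + h)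

/-- The open brick with index `a` and side length `h`. -/
def brickCore (h : ℝ) (a : ℤ × ℤ) : Set ℂ :=
  Set.Ioo ((a.1 + a.2 / 2) * h) ((a.1 + a.2 / 2) * h + h) ×ℂ Set.Ioo (a.2 * h) (a.2 * h + h)

/-- The center of a brick. -/
noncomputable def brickCenter (h : ℝ) (a : ℤ × ℤ) : ℂ :=
  ⟨(a.1 + a.2 / 2) * h + h / 2, a.2 * h + h / 2⟩

theorem int_sub_lt_one_of_brick {h x : ℝ} (hh : 0 < h) {i j : ℝ} (h1 : i * h ≤ x)
    (h2 : x ≤ j * h + h) : i - j ≤ 1 := by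
  have : (i - j) * h ≤ 1 * h := by linarith
  exact le_of_mul_le_mul_right this hh

theorem brick_neighbors {h : ℝ} (hh : 0 < h) {a b : ℤ × ℤ}
    (hab : (brickTile h a ∩ brickTile h b).Nonempty) :
    b = a ∨ b = a + (1, 0) ∨ a = b + (1, 0) ∨ b = a + (0, 1) ∨ a = b + (0, 1) ∨
      b = a + (-1, 1) ∨ a = b + (-1, 1) := by
  obtain ⟨z, ⟨⟨h1, h2⟩, h3, h4⟩, ⟨h5, h6⟩, h7, h8⟩ := hab
  have k1 := int_sub_lt_one_of_brick hh h3 h8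
  have k2 := int_sub_lt_one_of_brick hh h7 h4
  have k3 := int_sub_lt_one_of_brick hh h1 h6
  have k4 := int_sub_lt_one_of_brick hh h5 h2
  have l1 : a.2 - b.2 ≤ 1 := by exact_mod_cast k1
  have l2 : b.2 - a.2 ≤ 1 := by exact_mod_cast k2
  have l3 : 2 * a.1 + a.2 - (2 * b.1 + b.2) ≤ 2 := by
    have : 2 * (a.1 : ℝ) + a.2 - (2 * b.1 + b.2) ≤ 2 := by linarith
    exact_mod_cast this
  have l4 : 2 * b.1 + b.2 - (2 * a.1 + a.2) ≤ 2 := by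
    have : 2 * (b.1 : ℝ) + b.2 - (2 * a.1 + a.2) ≤ 2 := by linarith
    exact_mod_cast this
  simp only [Prod.ext_iff, Prod.fst_add, Prod.snd_add]
  omega

theorem brick_joinedIn_center {h : ℝ} (hh : 0 < h) {a b : ℤ × ℤ}
    (hab : (brickTile h a ∩ brickTile h b).Nonempty) :
    JoinedIn (interior (brickTile h a ∪ brickTile h b)) (brickCenter h a) (brickCenter h b) := by
  have hself : ∀ a : ℤ × ℤ, brickCenter h a ∈ interior (brickTile h a ∪ brickTile h a) := by
    intro a
    rw [Set.union_self, brickTile, Complex.interior_reProdIm, interior_Icc, interior_Icc]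
    constructor <;> constructor <;> simp only [brickCenter] <;> linarith
  have hmem : ∀ (a : ℤ × ℤ) (X Y : ℝ), (a.1 + a.2 / 2) * h = X → a.2 * h = Y → ∀ z : ℂ,
      z.re ∈ Set.Icc X (X + h) → z.im ∈ Set.Icc Y (Y + h) → z ∈ brickTile h a := by
    rintro a _ _ rfl rfl z h1 h2
    exact ⟨h1, h2⟩
  have hcen : ∀ (a : ℤ × ℤ) (X Y : ℝ), (a.1 + a.2 / 2) * h = X → a.2 * h = Y →
      brickCenter h a = ⟨X + h / 2, Y + h / 2⟩ := by
    rintro a _ _ rfl rfl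
    rfl
  have key : ∀ a d : ℤ × ℤ, (d = (1, 0) ∨ d = (0, 1) ∨ d = (-1, 1)) →
      JoinedIn (interior (brickTile h a ∪ brickTile h (a + d))) (brickCenter h a)
        (brickCenter h (a + d)) := by
    intro a d hd
    rcases hd with rfl | rfl | rfl
    · have e₁ : (((a + (1, 0)).1 : ℝ) + ((a + (1, 0)).2 : ℝ) / 2) * h =
          (a.1 + a.2 / 2) * h + h := by
        simp only [Prod.fst_add, Prod.snd_add]
        push_cast
        ring
      have e₂ : ((a + (1, 0)).2 : ℝ) * h = a.2 * h := by
        simp only [Prod.snd_add]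
        push_cast
        ring
      rw [hcen _ _ _ e₁ e₂, hcen a _ _ rfl rfl]
      exact joinedIn_row_brick hh (hmem a _ _ rfl rfl) (hmem _ _ _ e₁ e₂)
    · have e₁ : (((a + (0, 1)).1 : ℝ) + ((a + (0, 1)).2 : ℝ) / 2) * h =
          (a.1 + a.2 / 2) * h + h / 2 := by
        simp only [Prod.fst_add, Prod.snd_add]
        push_cast
        ring
      have e₂ : ((a + (0, 1)).2 : ℝ) * h = a.2 * h + h := by
        simp only [Prod.snd_add]
        push_cast
        ring
      rw [hcen _ _ _ e₁ e₂, hcen a _ _ rfl rfl]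
      exact joinedIn_symmetric_brick hh (Or.inl rfl) (hmem a _ _ rfl rfl) (hmem _ _ _ e₁ e₂)
    · have e₁ : (((a + (-1, 1)).1 : ℝ) + ((a + (-1, 1)).2 : ℝ) / 2) * h =
          (a.1 + a.2 / 2) * h + -(h / 2) := by
        simp only [Prod.fst_add, Prod.snd_add]
        push_cast
        ring
      have e₂ : ((a + (-1, 1)).2 : ℝ) * h = a.2 * h + h := by
        simp only [Prod.snd_add]
        push_cast
        ring
      rw [hcen _ _ _ e₁ e₂, hcen a _ _ rfl rfl]
      exact joinedIn_symmetric_brick hh (Or.inr rfl) (hmem a _ _ rfl rfl) (hmem _ _ _ e₁ e₂)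
  rcases brick_neighbors hh hab with rfl | rfl | rfl | rfl | rfl | rfl | rfl
  · exact JoinedIn.refl (hself _)
  · exact key _ _ (by simp)
  · rw [Set.union_comm]
    exact (key _ _ (by simp)).symm
  · exact key _ _ (by simp)
  · rw [Set.union_comm]
    exact (key _ _ (by simp)).symm
  · exact key _ _ (by simp)
  · rw [Set.union_comm]
    exact (key _ _ (by simp)).symm

theorem brick_locallyFinite {h : ℝ} (hh : 0 < h) : LocallyFinite (brickTile h) := by
  intro z
  refine ⟨Metric.ball z 1, Metric.ball_mem_nhds z one_pos, ?_⟩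
  obtain ⟨Q, hQ⟩ := exists_nat_ge ((‖z‖ + 1) / h)
  refine ((Set.finite_Icc (-(2 * Q + 2 : ℤ)) (2 * Q + 2)).prod
    (Set.finite_Icc (-(2 * Q + 2 : ℤ)) (2 * Q + 2))).subset ?_
  rintro a ⟨w, ⟨⟨h1, h2⟩, h3, h4⟩, hw⟩
  have hwn : ‖w‖ < ‖z‖ + 1 := by
    rw [Metric.mem_ball, dist_eq_norm] at hw
    have := norm_le_norm_add_norm_sub z w
    rw [norm_sub_rev] at this
    linarith
  have hwQ : ‖w‖ ≤ Q * h := by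
    rw [div_le_iff₀ hh] at hQ
    linarith
  have r1 := abs_le.1 ((Complex.abs_re_le_norm w).trans hwQ)
  have r2 := abs_le.1 ((Complex.abs_im_le_norm w).trans hwQ)
  have k1 : (a.2 : ℝ) ≤ Q := le_of_mul_le_mul_right (by linarith : a.2 * h ≤ Q * h) hh
  have k2 : (-Q - 1 : ℝ) ≤ a.2 := le_of_mul_le_mul_right (by linarith : (-Q - 1) * h ≤ a.2 * h) hh
  have k3 : (a.1 + a.2 / 2 : ℝ) ≤ Q := le_of_mul_le_mul_right (by linarith) hh
  have k4 : (-Q - 1 : ℝ) ≤ a.1 + a.2 / 2 :=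
    le_of_mul_le_mul_right (by linarith : (-Q - 1) * h ≤ (a.1 + a.2 / 2 : ℝ) * h) hh
  have hQ0 : (0 : ℝ) ≤ Q := Nat.cast_nonneg _
  have m1 : (a.1 : ℝ) ≤ 2 * Q + 2 := by linarith
  have m2 : (-(2 * Q + 2) : ℝ) ≤ a.1 := by linarith
  have m3 : (a.2 : ℝ) ≤ 2 * Q + 2 := by linarith
  have m4 : (-(2 * Q + 2) : ℝ) ≤ a.2 := by linarith
  exact ⟨⟨by exact_mod_cast m2, by exact_mod_cast m1⟩, ⟨by exact_mod_cast m4, by exact_mod_cast m3⟩⟩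

/-- The action of the lattice on the indices of the bricks of side length `1 / (2 * M)`. -/
def brickShift (M : ℤ) : ℤ × ℤ →+ ℤ × ℤ where
  toFun m := (2 * M * m.1 - M * m.2, 2 * M * m.2)
  map_zero' := by simp
  map_add' m n := by
    simp only [Prod.fst_add, Prod.snd_add, Prod.mk_add_mk]
    congr 1 <;> ring

theorem brick_eq_of_core_inter {h : ℝ} (hh : 0 < h) {a b : ℤ × ℤ} {z : ℂ} (ha : z ∈ brickCore h a)
    (hb : z ∈ brickCore h b) : a = b := by
  obtain ⟨⟨h1, h2⟩, h3, h4⟩ := ha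
  obtain ⟨⟨h5, h6⟩, h7, h8⟩ := hb
  have k1 : (a.2 : ℝ) < b.2 + 1 := lt_of_mul_lt_mul_right (by linarith) hh.le
  have k2 : (b.2 : ℝ) < a.2 + 1 := lt_of_mul_lt_mul_right (by linarith) hh.le
  have l1 : a.2 < b.2 + 1 := by exact_mod_cast k1
  have l2 : b.2 < a.2 + 1 := by exact_mod_cast k2
  have e2 : a.2 = b.2 := by omega
  rw [e2] at h1 h2
  have k3 : (a.1 + b.2 / 2 : ℝ) < b.1 + b.2 / 2 + 1 :=
    lt_of_mul_lt_mul_right (by linarith) hh.le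
  have k4 : (b.1 + b.2 / 2 : ℝ) < a.1 + b.2 / 2 + 1 :=
    lt_of_mul_lt_mul_right (by linarith) hh.le
  have l3 : a.1 < b.1 + 1 := by
    have : (a.1 : ℝ) < b.1 + 1 := by linarith
    exact_mod_cast this
  have l4 : b.1 < a.1 + 1 := by
    have : (b.1 : ℝ) < a.1 + 1 := by linarith
    exact_mod_cast this
  exact Prod.ext (by omega) e2

/-- The brick tiling with bricks of side length `1 / (2 * M)`. -/
noncomputable def brickTiling (M : ℕ) (hM : 0 < M) : PlaneTiling :=
  have hh : (0 : ℝ) < 1 / (2 * M) := by positivity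
  have hre : ∀ a m : ℤ × ℤ, (((a + brickShift M m).1 : ℝ) + (a + brickShift M m).2 / 2) *
      (1 / (2 * M)) = (a.1 + a.2 / 2) * (1 / (2 * M)) + m.1 := fun a m => by
    have : (M : ℝ) ≠ 0 := by positivity
    simp only [brickShift, AddMonoidHom.coe_mk, ZeroHom.coe_mk, Prod.fst_add, Prod.snd_add]
    push_cast
    field_simp
    ring
  have him : ∀ a m : ℤ × ℤ, ((a + brickShift M m).2 : ℝ) * (1 / (2 * M)) =
      a.2 * (1 / (2 * M)) + m.2 := fun a m => by
    have : (M : ℝ) ≠ 0 := by positivity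
    simp only [brickShift, AddMonoidHom.coe_mk, ZeroHom.coe_mk, Prod.snd_add]
    push_cast
    field_simp
  { tile := brickTile (1 / (2 * M))
    core := brickCore (1 / (2 * M))
    center := brickCenter (1 / (2 * M))
    shift := brickShift M
    isOpen_core := fun _ => isOpen_Ioo.reProdIm isOpen_Ioo
    convex_core := fun _ => ((convex_Ioo _ _).linear_preimage Complex.reLm).inter
      ((convex_Ioo _ _).linear_preimage Complex.imLm)
    center_mem_core := fun a => by
      constructor <;> constructor <;> simp only [brickCenter] <;> linarith
    closure_core := fun a => by
      rw [brickCore, Complex.closure_reProdIm, closure_Ioo (by linarith), closure_Ioo (by linarith)]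
      rfl
    eq_of_mem_core := fun _ _ _ h1 h2 => brick_eq_of_core_inter hh h1 h2
    isCompact_tile := fun a => by
      refine Metric.isCompact_of_isClosed_isBounded (isClosed_Icc.reProdIm isClosed_Icc) ?_
      exact (Metric.isBounded_Icc _ _).reProdIm (Metric.isBounded_Icc _ _)
    exists_mem_tile := fun z => by
      refine ⟨(⌊z.re / (1 / (2 * M)) - (⌊z.im / (1 / (2 * M))⌋ : ℝ) / 2⌋,
        ⌊z.im / (1 / (2 * M))⌋), ?_⟩
      have h1 := Int.floor_le (z.im / (1 / (2 * M)))
      have h2 := Int.lt_floor_add_one (z.im / (1 / (2 * M)))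
      have h3 := Int.floor_le (z.re / (1 / (2 * M)) - (⌊z.im / (1 / (2 * M))⌋ : ℝ) / 2)
      have h4 := Int.lt_floor_add_one (z.re / (1 / (2 * M)) - (⌊z.im / (1 / (2 * M))⌋ : ℝ) / 2)
      rw [le_sub_iff_add_le, le_div_iff₀ hh] at h3
      rw [sub_lt_iff_lt_add, div_lt_iff₀ hh] at h4
      rw [le_div_iff₀ hh] at h1
      rw [div_lt_iff₀ hh] at h2
      constructor <;> constructor <;> linarith
    locallyFinite_tile := brick_locallyFinite hh
    joinedIn_center := fun _ _ => brick_joinedIn_center hh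
    core_add_shift := fun a m z => by
      simp only [brickCore, Complex.mem_reProdIm, hre, him, Complex.sub_re, Complex.sub_im,
        latticePoint_re, latticePoint_im, Set.mem_Ioo]
      constructor <;> rintro ⟨⟨h1, h2⟩, h3, h4⟩ <;> refine ⟨⟨?_, ?_⟩, ?_, ?_⟩ <;> linarith
    tile_add_shift := fun a m z => by
      simp only [brickTile, Complex.mem_reProdIm, hre, him, Complex.sub_re, Complex.sub_im,
        latticePoint_re, latticePoint_im, Set.mem_Icc]
      constructor <;> rintro ⟨⟨h1, h2⟩, h3, h4⟩ <;> refine ⟨⟨?_, ?_⟩, ?_, ?_⟩ <;> linarith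
    center_add_shift := fun a m => by
      apply Complex.ext
      · simp only [brickCenter, hre, Complex.add_re, latticePoint_re]
        ring
      · simp only [brickCenter, him, Complex.add_im, latticePoint_im]
        ring
    exists_finset := by
      refine ⟨Finset.Icc (0 : ℤ) (2 * M) ×ˢ Finset.Icc (0 : ℤ) (2 * M), fun a => ?_⟩
      have hM' : (0 : ℤ) < 2 * M := by positivity
      refine ⟨(-((a.1 + M * -(a.2 / (2 * M)) * (-1)) / (2 * M)), -(a.2 / (2 * M))), ?_⟩
      have h1 := Int.emod_add_mul_ediv (a.1 + M * -(a.2 / (2 * M)) * (-1)) (2 * M)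
      have h2 := Int.emod_nonneg (a.1 + M * -(a.2 / (2 * M)) * (-1)) hM'.ne'
      have h3 := Int.emod_lt_of_pos (a.1 + M * -(a.2 / (2 * M)) * (-1)) hM'
      have h4 := Int.emod_add_mul_ediv a.2 (2 * M)
      have h5 := Int.emod_nonneg a.2 hM'.ne'
      have h6 := Int.emod_lt_of_pos a.2 hM'
      simp only [brickShift, AddMonoidHom.coe_mk, ZeroHom.coe_mk, Finset.mem_product,
        Finset.mem_Icc, Prod.fst_add, Prod.snd_add]
      refine ⟨⟨?_, ?_⟩, ?_, ?_⟩ <;> linarith }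

theorem exists_planeTiling {δ : ℝ} (hδ : 0 < δ) :
    ∃ T : PlaneTiling, ∀ a, ∀ z ∈ T.tile a, ∀ w ∈ T.tile a, ‖z - w‖ < δ := by
  obtain ⟨M, hM⟩ := exists_nat_gt (1 / δ)
  have hM0 : (0 : ℝ) < M := (by positivity : 0 < 1 / δ).trans hM
  refine ⟨brickTiling M (by exact_mod_cast hM0), fun a z hz w hw => ?_⟩
  obtain ⟨⟨h1, h2⟩, h3, h4⟩ := hz
  obtain ⟨⟨h5, h6⟩, h7, h8⟩ := hw
  refine (Complex.norm_le_abs_re_add_abs_im _).trans_lt ?_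
  have k1 : |(z - w).re| ≤ 1 / (2 * M) := by
    rw [Complex.sub_re, abs_le]
    constructor <;> linarith
  have k2 : |(z - w).im| ≤ 1 / (2 * M) := by
    rw [Complex.sub_im, abs_le]
    constructor <;> linarith
  have k3 : (1 : ℝ) / (2 * M) + 1 / (2 * M) = 1 / M := by
    field_simp
    norm_num
  have k4 : 1 / (M : ℝ) < δ := by
    rw [div_lt_iff₀ hM0]
    rw [div_lt_iff₀ hδ] at hM
    linarith
  linarith

namespace PlaneTiling

variable (T : PlaneTiling)

/-- Two tiles meet. -/
def Touch (a b : ℤ × ℤ) : Prop := (T.tile a ∩ T.tile b).Nonempty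

/-- Two tiles of `S` are connected by a chain of touching tiles of `S`. -/
def Joined (S : Set (ℤ × ℤ)) (a b : ℤ × ℤ) : Prop :=
  a ∈ S ∧ Relation.ReflTransGen (fun x y => y ∈ S ∧ T.Touch x y) a b

/-- The open region covered by a set of tiles. -/
def region (S : Set (ℤ × ℤ)) : Set ℂ := interior (⋃ a ∈ S, T.tile a)

/-- The image of the first tile meets the second one. -/
def Arrow (F : ℂ ≃ₜ ℂ) (a b : ℤ × ℤ) : Prop := ∃ z ∈ T.core a, F z ∈ T.core b

variable {T}

theorem Touch.symm {a b : ℤ × ℤ} (h : T.Touch a b) : T.Touch b a := by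
  rwa [Touch, Set.inter_comm] at h

theorem core_subset_tile (a : ℤ × ℤ) : T.core a ⊆ T.tile a :=
  T.closure_core a ▸ subset_closure

theorem tile_nonempty (a : ℤ × ℤ) : (T.tile a).Nonempty :=
  ⟨_, core_subset_tile a (T.center_mem_core a)⟩

theorem Touch.refl (a : ℤ × ℤ) : T.Touch a a := by
  rw [Touch, Set.inter_self]
  exact tile_nonempty a

theorem isPreconnected_tile (a : ℤ × ℤ) : IsPreconnected (T.tile a) :=
  T.closure_core a ▸ (T.convex_core a).closure.isPreconnected

theorem Joined.refl {S : Set (ℤ × ℤ)} {a : ℤ × ℤ} (ha : a ∈ S) : T.Joined S a a := ⟨ha, .refl⟩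

theorem Joined.right_mem {S : Set (ℤ × ℤ)} {a b : ℤ × ℤ} (h : T.Joined S a b) : b ∈ S := by
  obtain ⟨ha, h⟩ := h
  induction h with
  | refl => exact ha
  | tail _ h _ => exact h.1

theorem Joined.trans {S : Set (ℤ × ℤ)} {a b c : ℤ × ℤ} (h : T.Joined S a b)
    (h' : T.Joined S b c) : T.Joined S a c := ⟨h.1, h.2.trans h'.2⟩

theorem Touch.joined {S : Set (ℤ × ℤ)} {a b : ℤ × ℤ} (h : T.Touch a b) (ha : a ∈ S)
    (hb : b ∈ S) : T.Joined S a b := ⟨ha, .single ⟨hb, h⟩⟩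

theorem Joined.symm {S : Set (ℤ × ℤ)} {a b : ℤ × ℤ} (h : T.Joined S a b) : T.Joined S b a := by
  obtain ⟨ha, h⟩ := h
  induction h with
  | refl => exact .refl ha
  | tail h' h ih => exact (h.2.symm.joined h.1 (Joined.right_mem ⟨ha, h'⟩)).trans ih

theorem Joined.mono {S S' : Set (ℤ × ℤ)} (hS : S ⊆ S') {a b : ℤ × ℤ} (h : T.Joined S a b) :
    T.Joined S' a b :=
  ⟨hS h.1, Relation.ReflTransGen.mono (fun _ _ h => ⟨hS h.1, h.2⟩) _ _ h.2⟩

theorem Touch.add_shift {a b : ℤ × ℤ} (h : T.Touch a b) (m : ℤ × ℤ) :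
    T.Touch (a + T.shift m) (b + T.shift m) := by
  obtain ⟨z, h1, h2⟩ := h
  exact ⟨z + latticePoint m, by simpa [T.tile_add_shift] using h1,
    by simpa [T.tile_add_shift] using h2⟩

theorem Joined.add_shift {S S' : Set (ℤ × ℤ)} {a b : ℤ × ℤ} (h : T.Joined S a b) (m : ℤ × ℤ)
    (hS : ∀ x ∈ S, x + T.shift m ∈ S') : T.Joined S' (a + T.shift m) (b + T.shift m) := by
  obtain ⟨ha, h⟩ := h
  refine ⟨hS _ ha, ?_⟩
  exact h.lift (fun x => x + T.shift m) fun x y h => ⟨hS _ h.1, h.2.add_shift m⟩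

theorem shift_injective : Function.Injective T.shift := by
  intro m n h
  have h1 := T.center_add_shift 0 m
  rw [h, T.center_add_shift, add_right_inj] at h1
  have h2 := congrArg Complex.re h1
  have h3 := congrArg Complex.im h1
  rw [latticePoint_re, latticePoint_re, Int.cast_inj] at h2
  rw [latticePoint_im, latticePoint_im, Int.cast_inj] at h3
  exact Prod.ext h2.symm h3.symm

theorem finite_setOf_inter {K : Set ℂ} (hK : IsCompact K) :
    {a | (T.tile a ∩ K).Nonempty}.Finite :=
  T.locallyFinite_tile.finite_nonempty_inter_compact hK

theorem finite_touch (a : ℤ × ℤ) : {b | T.Touch a b}.Finite :=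
  (finite_setOf_inter (T.isCompact_tile a)).subset fun _ h => Touch.symm h

theorem isClosed_biUnion_tile (S : Set (ℤ × ℤ)) : IsClosed (⋃ a ∈ S, T.tile a) := by
  rw [Set.biUnion_eq_iUnion]
  exact (T.locallyFinite_tile.comp_injective Subtype.val_injective).isClosed_iUnion
    fun a => (T.isCompact_tile _).isClosed

theorem isOpen_region (S : Set (ℤ × ℤ)) : IsOpen (T.region S) := isOpen_interior

theorem core_subset_region {S : Set (ℤ × ℤ)} {a : ℤ × ℤ} (ha : a ∈ S) :
    T.core a ⊆ T.region S :=
  interior_maximal ((core_subset_tile a).trans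
    (Set.subset_biUnion_of_mem (u := fun a => T.tile a) ha)) (T.isOpen_core a)

theorem Joined.joinedIn {S : Set (ℤ × ℤ)} {a b : ℤ × ℤ} (h : T.Joined S a b) :
    JoinedIn (T.region S) (T.center a) (T.center b) := by
  obtain ⟨ha, h⟩ := h
  induction h with
  | refl => exact JoinedIn.refl (core_subset_region ha (T.center_mem_core a))
  | tail h' h ih =>
    have hb := Joined.right_mem ⟨ha, h'⟩
    refine ih.trans ((T.joinedIn_center _ _ h.2).mono (interior_mono ?_))
    exact Set.union_subset (Set.subset_biUnion_of_mem (u := fun a => T.tile a) hb)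
      (Set.subset_biUnion_of_mem (u := fun a => T.tile a) h.1)

/-- An open set meeting a region meets the core of one of its tiles. -/
theorem exists_core_inter {S : Set (ℤ × ℤ)} {V : Set ℂ} (hV : IsOpen V) {z : ℂ} (hz : z ∈ V)
    (hzS : z ∈ T.region S) : ∃ a ∈ S, (V ∩ T.core a).Nonempty := by
  obtain ⟨a, ha, hza⟩ := Set.mem_iUnion₂.1 (interior_subset hzS)
  rw [← T.closure_core] at hza
  exact ⟨a, ha, mem_closure_iff.1 hza V hV hz⟩

theorem arrow_of_mem_region {F : ℂ ≃ₜ ℂ} {S S' : Set (ℤ × ℤ)} {z : ℂ} (hz : z ∈ T.region S)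
    (hFz : F z ∈ T.region S') : ∃ a ∈ S, ∃ b ∈ S', T.Arrow F a b := by
  obtain ⟨a, ha, w, hw, hwa⟩ := exists_core_inter
    ((isOpen_region S').preimage F.continuous) hFz hz
  obtain ⟨b, hb, _, ⟨v, hv, rfl⟩, hvb⟩ := exists_core_inter (F.isOpenMap _ (T.isOpen_core a))
    (Set.mem_image_of_mem F hwa) hw
  exact ⟨a, ha, b, hb, v, hv, hvb⟩

theorem exists_mem_of_mem_region {S S' : Set (ℤ × ℤ)} {z : ℂ} (hz : z ∈ T.region S)
    (hz' : z ∈ T.region S') : ∃ a ∈ S, a ∈ S' := by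
  obtain ⟨a, ha, b, hb, w, h1, h2⟩ := arrow_of_mem_region (F := Homeomorph.refl ℂ) hz hz'
  exact ⟨a, ha, T.eq_of_mem_core a b w h1 h2 ▸ hb⟩

theorem isPreconnected_region {S : Set (ℤ × ℤ)} (hS : ∀ a ∈ S, ∀ b ∈ S, T.Joined S a b) :
    IsPreconnected (T.region S) := by
  have hcen : ∀ z ∈ T.region S, ∃ a ∈ S, JoinedIn (T.region S) z (T.center a) := by
    intro z hz
    obtain ⟨r, hr, hball⟩ := Metric.isOpen_iff.1 (isOpen_region S) z hz
    obtain ⟨a, ha, w, hw, hwa⟩ := exists_core_inter Metric.isOpen_ball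
      (Metric.mem_ball_self hr) hz
    refine ⟨a, ha, (JoinedIn.of_segment_subset ?_).trans (JoinedIn.of_segment_subset (y := T.center a)
      (((T.convex_core a).segment_subset hwa (T.center_mem_core a)).trans
        (core_subset_region ha)))⟩
    exact ((convex_ball z r).segment_subset (Metric.mem_ball_self hr) hw).trans hball
  rcases (T.region S).eq_empty_or_nonempty with h | h
  · rw [h]
    exact isPreconnected_empty
  · refine (isPathConnected_iff.2 ⟨h, fun x hx y hy => ?_⟩).isConnected.isPreconnected
    obtain ⟨a, ha, hxa⟩ := hcen x hx
    obtain ⟨b, hb, hyb⟩ := hcen y hy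
    exact (hxa.trans (hS a ha b hb).joinedIn).trans hyb.symm

theorem arrow_symm_iff {F : ℂ ≃ₜ ℂ} {a b : ℤ × ℤ} : T.Arrow F.symm a b ↔ T.Arrow F b a := by
  constructor
  · rintro ⟨z, h1, h2⟩
    exact ⟨_, h2, by simpa using h1⟩
  · rintro ⟨z, h1, h2⟩
    exact ⟨_, h2, by simpa using h1⟩

theorem Arrow.add_shift {F : ℂ ≃ₜ ℂ} (hF : ∀ z m, F (z + latticePoint m) = F z + latticePoint m)
    {a b : ℤ × ℤ} (h : T.Arrow F a b) (m : ℤ × ℤ) :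
    T.Arrow F (a + T.shift m) (b + T.shift m) := by
  obtain ⟨z, h1, h2⟩ := h
  exact ⟨z + latticePoint m, by simpa [T.core_add_shift] using h1,
    by simpa [T.core_add_shift, hF] using h2⟩

/-- The image of a tile is covered by the tiles its core is sent to. -/
theorem exists_arrow_mem_tile {F : ℂ ≃ₜ ℂ} {a : ℤ × ℤ} {z : ℂ} (hz : z ∈ T.tile a) :
    ∃ b, T.Arrow F a b ∧ F z ∈ T.tile b := by
  have hsub : F '' T.core a ⊆ ⋃ b ∈ {b | T.Arrow F a b}, T.tile b := by
    rintro _ ⟨w, hw, rfl⟩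
    obtain ⟨b, hb⟩ := T.exists_mem_tile (F w)
    refine Set.mem_biUnion ?_ hb
    rw [← T.closure_core] at hb
    obtain ⟨_, ⟨v, hv, rfl⟩, hvb⟩ := mem_closure_iff.1 hb _ (F.isOpenMap _ (T.isOpen_core a))
      (Set.mem_image_of_mem F hw)
    exact ⟨v, hv, hvb⟩
  have hFz : F z ∈ closure (F '' T.core a) := by
    rw [← F.image_closure, T.closure_core]
    exact Set.mem_image_of_mem F hz
  obtain ⟨b, hb, h⟩ := Set.mem_iUnion₂.1 ((isClosed_biUnion_tile _).closure_subset_iff.2 hsub hFz)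
  exact ⟨b, hb, h⟩

/-- The tiles met by a connected set form a connected family. -/
theorem joined_of_isPreconnected {C : Set ℂ} (hC : IsPreconnected C) {Y : Set (ℤ × ℤ)}
    (hcov : C ⊆ ⋃ b ∈ Y, T.tile b) (hne : ∀ b ∈ Y, (C ∩ T.tile b).Nonempty) {b₁ b₂ : ℤ × ℤ}
    (h₁ : b₁ ∈ Y) (h₂ : b₂ ∈ Y) : T.Joined Y b₁ b₂ := by
  by_contra hcon
  have hC' := isPreconnected_closed_iff.1 hC (⋃ b ∈ {b | b ∈ Y ∧ T.Joined Y b₁ b}, T.tile b)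
    (⋃ b ∈ {b | b ∈ Y ∧ ¬ T.Joined Y b₁ b}, T.tile b) (isClosed_biUnion_tile _)
    (isClosed_biUnion_tile _) (fun z hz => ?_) ?_ ?_
  · obtain ⟨z, -, hz1, hz2⟩ := hC'
    obtain ⟨b, hb, hzb⟩ := Set.mem_iUnion₂.1 hz1
    obtain ⟨c, hc, hzc⟩ := Set.mem_iUnion₂.1 hz2
    exact hc.2 (hb.2.trans (Touch.joined ⟨z, hzb, hzc⟩ hb.1 hc.1))
  · obtain ⟨b, hb, hzb⟩ := Set.mem_iUnion₂.1 (hcov hz)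
    by_cases h : T.Joined Y b₁ b
    · exact Or.inl (Set.mem_biUnion (show b ∈ {b | b ∈ Y ∧ T.Joined Y b₁ b} from ⟨hb, h⟩) hzb)
    · exact Or.inr (Set.mem_biUnion (show b ∈ {b | b ∈ Y ∧ ¬ T.Joined Y b₁ b} from ⟨hb, h⟩) hzb)
  · obtain ⟨z, hz, hz'⟩ := hne b₁ h₁
    exact ⟨z, hz, Set.mem_biUnion (show b₁ ∈ {b | b ∈ Y ∧ T.Joined Y b₁ b} from ⟨h₁, .refl h₁⟩) hz'⟩
  · obtain ⟨z, hz, hz'⟩ := hne b₂ h₂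
    exact ⟨z, hz, Set.mem_biUnion (show b₂ ∈ {b | b ∈ Y ∧ ¬ T.Joined Y b₁ b} from ⟨h₂, hcon⟩) hz'⟩

/-- The tiles met by the image of two touching tiles form a connected family. -/
theorem Touch.joined_image {F : ℂ ≃ₜ ℂ} {a₁ a₂ b₁ b₂ : ℤ × ℤ} (h : T.Touch a₁ a₂)
    (h₁ : T.Arrow F a₁ b₁ ∨ T.Arrow F a₂ b₁) (h₂ : T.Arrow F a₁ b₂ ∨ T.Arrow F a₂ b₂) :
    T.Joined {b | T.Arrow F a₁ b ∨ T.Arrow F a₂ b} b₁ b₂ := by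
  have hC : IsPreconnected (F '' (T.tile a₁ ∪ T.tile a₂)) := by
    obtain ⟨z, hz1, hz2⟩ := h
    exact ((isPreconnected_tile a₁).union z hz1 hz2 (isPreconnected_tile a₂)).image _
      F.continuous.continuousOn
  refine joined_of_isPreconnected hC ?_ ?_ h₁ h₂
  · rintro _ ⟨z, hz, rfl⟩
    rcases hz with hz | hz
    · obtain ⟨b, hb, hzb⟩ := exists_arrow_mem_tile (F := F) hz
      exact Set.mem_biUnion (show b ∈ {b | T.Arrow F a₁ b ∨ T.Arrow F a₂ b} from Or.inl hb) hzb
    · obtain ⟨b, hb, hzb⟩ := exists_arrow_mem_tile (F := F) hz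
      exact Set.mem_biUnion (show b ∈ {b | T.Arrow F a₁ b ∨ T.Arrow F a₂ b} from Or.inr hb) hzb
  · rintro b (⟨z, h1, h2⟩ | ⟨z, h1, h2⟩)
    · exact ⟨F z, Set.mem_image_of_mem F (Or.inl (core_subset_tile _ h1)), core_subset_tile _ h2⟩
    · exact ⟨F z, Set.mem_image_of_mem F (Or.inr (core_subset_tile _ h1)), core_subset_tile _ h2⟩

end PlaneTiling

namespace PlaneTiling

variable {T : PlaneTiling} {F : ℂ ≃ₜ ℂ} {s : Setoid (ℤ × ℤ)}

/-- An equivariant partition of the tiles into connected families whose regions are disjoint from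
their images and from their lattice translates. -/
structure IsFreePartition (T : PlaneTiling) (F : ℂ ≃ₜ ℂ) (s : Setoid (ℤ × ℤ)) : Prop where
  add_shift : ∀ {a b : ℤ × ℤ}, s a b → ∀ m, s (a + T.shift m) (b + T.shift m)
  joined : ∀ {a b : ℤ × ℤ}, s a b → T.Joined {c | s a c} a b
  not_arrow : ∀ {a b : ℤ × ℤ}, s a b → ¬ T.Arrow F a b
  eq_zero : ∀ {a m : ℤ × ℤ}, s a (a + T.shift m) → m = 0

/-- The image of the region of the class of `a` meets the region of the class of `b`. -/
def Leads (T : PlaneTiling) (F : ℂ ≃ₜ ℂ) (s : Setoid (ℤ × ℤ)) (a b : ℤ × ℤ) : Prop :=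
  ∃ a' b', s a a' ∧ s b b' ∧ T.Arrow F a' b'

theorem Arrow.leads {a b : ℤ × ℤ} (h : T.Arrow F a b) : T.Leads F s a b :=
  ⟨a, b, s.refl a, s.refl b, h⟩

theorem Leads.congr {a b a' b' : ℤ × ℤ} (h : T.Leads F s a b) (ha : s a a') (hb : s b b') :
    T.Leads F s a' b' := by
  obtain ⟨x, y, h1, h2, h3⟩ := h
  exact ⟨x, y, s.trans (s.symm ha) h1, s.trans (s.symm hb) h2, h3⟩

theorem leads_symm_iff {a b : ℤ × ℤ} : T.Leads F.symm s a b ↔ T.Leads F s b a := by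
  constructor
  · rintro ⟨x, y, h1, h2, h3⟩
    exact ⟨y, x, h2, h1, arrow_symm_iff.1 h3⟩
  · rintro ⟨x, y, h1, h2, h3⟩
    exact ⟨y, x, h2, h1, arrow_symm_iff.2 h3⟩

namespace IsFreePartition

theorem symm (h : T.IsFreePartition F s) : T.IsFreePartition F.symm s where
  add_shift := h.add_shift
  joined := h.joined
  not_arrow hab hA := h.not_arrow (s.symm hab) (arrow_symm_iff.1 hA)
  eq_zero := h.eq_zero

theorem leads_add_shift (h : T.IsFreePartition F s)
    (hF : ∀ z m, F (z + latticePoint m) = F z + latticePoint m) {a b : ℤ × ℤ}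
    (hab : T.Leads F s a b) (m : ℤ × ℤ) : T.Leads F s (a + T.shift m) (b + T.shift m) := by
  obtain ⟨x, y, h1, h2, h3⟩ := hab
  exact ⟨_, _, h.add_shift h1 m, h.add_shift h2 m, h3.add_shift hF m⟩

/-- The images of the regions of a free partition never come back. -/
theorem not_transGen (h : T.IsFreePartition F s) (hB : HasBoundedDisplacement F)
    (hfix : ∀ z, F z ≠ z) (a : ℤ × ℤ) : ¬ Relation.TransGen (T.Leads F s) a a := by
  have key := not_transGen_of_free hB hfix
    (U := fun q : Quotient s => T.region {a | Quotient.mk s a = q})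
    (fun q => isOpen_region _) (fun q => isPreconnected_region ?_) ?_ ?_ (Quotient.mk s a)
  · refine fun hcon => key (hcon.lift (Quotient.mk s) fun x y hxy => ?_)
    obtain ⟨x', y', hx, hy, z, hz, hFz⟩ := hxy
    exact ⟨z, core_subset_region (a := x') (Quotient.sound (s.symm hx)) hz,
      core_subset_region (a := y') (Quotient.sound (s.symm hy)) hFz⟩
  · intro x hx y hy
    have hxy : s x y := Quotient.exact (hx.trans hy.symm)
    exact (h.joined hxy).mono fun c hc => (Quotient.sound (s.symm hc)).trans hx
  · intro p q hpq
    refine Set.disjoint_left.2 fun z hz hz' => hpq ?_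
    obtain ⟨x, hx, hx'⟩ := exists_mem_of_mem_region hz hz'
    exact hx.symm.trans hx'
  · intro q z hz hz'
    obtain ⟨x, hx, y, hy, hxy⟩ := arrow_of_mem_region hz hz'
    exact h.not_arrow (Quotient.exact (hx.trans hy.symm)) hxy

theorem finite_class (h : T.IsFreePartition F s) (a : ℤ × ℤ) : {b | s a b}.Finite := by
  obtain ⟨K, hK⟩ := T.exists_finset
  choose m hm using hK
  refine Set.Finite.of_injOn (f := fun b => b + T.shift (m b)) (t := K) (fun b _ => hm b) ?_
    K.finite_toSet
  intro b hb c hc hbc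
  have h1 : c = b + T.shift (m b - m c) := by
    rw [map_sub, ← add_sub_assoc, eq_sub_iff_add_eq]
    exact hbc.symm
  have h2 : s b (b + T.shift (m b - m c)) := h1 ▸ s.trans (s.symm hb) hc
  rw [h1, h.eq_zero h2, map_zero, add_zero]

end IsFreePartition

/-- Merging the classes of `a + shift m` and `c + shift m` for all `m`. -/
theorem IsFreePartition.exists_merge (h : T.IsFreePartition F s)
    (hF : ∀ z m, F (z + latticePoint m) = F z + latticePoint m) {a c : ℤ × ℤ}
    (hac : T.Touch a c) (hne : ∀ m, ¬ s a (c + T.shift m)) (h1 : ¬ T.Leads F s a c)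
    (h2 : ¬ T.Leads F s c a) : ∃ t, T.IsFreePartition F t ∧ s ≤ t ∧ t a c := by
  classical
  let σ : ℤ × ℤ → ℤ × ℤ := fun u =>
    if hu : ∃ m, s u (c + T.shift m) then a + T.shift hu.choose else u
  have hσ1 : ∀ u m, s u (c + T.shift m) → σ u = a + T.shift m := by
    intro u m hm
    have hu : ∃ m, s u (c + T.shift m) := ⟨m, hm⟩
    have hs : s (c + T.shift m) (c + T.shift m + T.shift (hu.choose - m)) := by
      rw [map_sub, add_assoc, add_sub_cancel]
      exact s.trans (s.symm hm) hu.choose_spec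
    simp only [σ, dif_pos hu]
    rw [sub_eq_zero.1 (h.eq_zero hs)]
  have hσ2 : ∀ u, (¬ ∃ m, s u (c + T.shift m)) → σ u = u := fun u hu => dif_neg hu
  have hσs : ∀ u v, s u v → s (σ u) (σ v) := by
    intro u v huv
    by_cases hu : ∃ m, s u (c + T.shift m)
    · obtain ⟨m, hm⟩ := hu
      rw [hσ1 u m hm, hσ1 v m (s.trans (s.symm huv) hm)]
    · rwa [hσ2 u hu, hσ2 v fun ⟨m, hm⟩ => hu ⟨m, s.trans huv hm⟩]
  have hσa : ∀ m, σ (a + T.shift m) = a + T.shift m := by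
    refine fun m => hσ2 _ fun ⟨n, hn⟩ => hne (n - m) ?_
    have := h.add_shift hn (-m)
    rwa [map_neg, add_neg_cancel_right, add_assoc, ← map_neg, ← map_add, ← sub_eq_add_neg] at this
  have hσadd : ∀ u m, σ (u + T.shift m) = σ u + T.shift m := by
    intro u m
    by_cases hu : ∃ n, s u (c + T.shift n)
    · obtain ⟨n, hn⟩ := hu
      have := h.add_shift hn m
      rw [add_assoc, ← map_add] at this
      rw [hσ1 u n hn, hσ1 _ _ this, map_add, add_assoc]
    · rw [hσ2 u hu, hσ2]
      rintro ⟨n, hn⟩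
      refine hu ⟨n - m, ?_⟩
      have := h.add_shift hn (-m)
      rwa [map_neg, add_neg_cancel_right, add_assoc, ← map_neg, ← map_add,
        ← sub_eq_add_neg] at this
  have hjoin : ∀ u, T.Joined {v | s (σ u) (σ v)} u (σ u) := by
    intro u
    by_cases hu : ∃ n, s u (c + T.shift n)
    · obtain ⟨n, hn⟩ := hu
      rw [hσ1 u n hn]
      refine ((h.joined hn).mono fun v hv => ?_).trans
        ((hac.symm.add_shift n).joined ?_ ?_)
      · rw [← hσ1 u n hn]
        exact hσs u v hv
      · change s _ (σ _)
        rw [hσ1 _ n (s.refl _)]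
      · change s _ (σ _)
        rw [hσa]
    · rw [hσ2 u hu]
      exact .refl (by change s u (σ u); rw [hσ2 u hu])
  refine ⟨s.comap σ, ⟨?_, ?_, ?_, ?_⟩, fun {u v} huv => hσs u v huv, ?_⟩
  · intro u v huv m
    change s (σ _) (σ _)
    rw [hσadd, hσadd]
    exact h.add_shift huv m
  · intro u v huv
    change s (σ u) (σ v) at huv
    have hσσ : ∀ w, σ (σ w) = σ w := by
      intro w
      by_cases hw : ∃ n, s w (c + T.shift n)
      · obtain ⟨n, hn⟩ := hw
        rw [hσ1 w n hn, hσa]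
      · rw [hσ2 w hw, hσ2 w hw]
    have h3 : T.Joined {w | s (σ u) (σ w)} (σ u) (σ v) := (h.joined huv).mono fun w hw => by
      have := hσs _ _ hw
      rwa [hσσ] at this
    exact ((hjoin u).trans h3).trans ((hjoin v).symm.mono fun w hw => s.trans huv hw)
  · intro u v huv hA
    change s (σ u) (σ v) at huv
    by_cases hu : ∃ n, s u (c + T.shift n) <;> by_cases hv : ∃ n, s v (c + T.shift n)
    · obtain ⟨n, hn⟩ := hu
      obtain ⟨k, hk⟩ := hv
      rw [hσ1 u n hn, hσ1 v k hk] at huv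
      have h3 : s (a + T.shift n) (a + T.shift n + T.shift (k - n)) := by
        rwa [map_sub, add_assoc, add_sub_cancel]
      obtain rfl := sub_eq_zero.1 (h.eq_zero h3)
      exact h.not_arrow (s.trans hn (s.symm hk)) hA
    · obtain ⟨n, hn⟩ := hu
      rw [hσ1 u n hn, hσ2 v hv] at huv
      have h3 := h.leads_add_shift hF (hA.leads.congr hn (s.symm huv)) (-n)
      rw [map_neg, add_neg_cancel_right, add_neg_cancel_right] at h3
      exact h2 h3
    · obtain ⟨n, hn⟩ := hv
      rw [hσ1 v n hn, hσ2 u hu] at huv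
      have h3 := h.leads_add_shift hF (hA.leads.congr huv hn) (-n)
      rw [map_neg, add_neg_cancel_right, add_neg_cancel_right] at h3
      exact h1 h3
    · rw [hσ2 u hu, hσ2 v hv] at huv
      exact h.not_arrow huv hA
  · intro u m hu
    change s (σ _) (σ _) at hu
    rw [hσadd] at hu
    exact h.eq_zero hu
  · change s (σ a) (σ c)
    have e1 := hσa 0
    have e2 := hσ1 c 0 (by rw [map_zero, add_zero])
    rw [map_zero, add_zero] at e1 e2
    rw [e1, e2]

/-- There are free partitions in which neighbouring classes, not related by a translation,
are comparable. -/
theorem exists_isFreePartition (hF : ∀ z m, F (z + latticePoint m) = F z + latticePoint m)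
    (hfree : ∀ a, ¬ T.Arrow F a a) :
    ∃ s, T.IsFreePartition F s ∧ ∀ a c, T.Touch a c → (∀ m, ¬ s a (c + T.shift m)) →
      T.Leads F s a c ∨ T.Leads F s c a := by
  have hub : ∀ C ⊆ {s | T.IsFreePartition F s}, IsChain (· ≤ ·) C → ∀ s₀ ∈ C,
      ∃ ub ∈ {s | T.IsFreePartition F s}, ∀ z ∈ C, z ≤ ub := by
    intro C hC hchain s₀ hs₀
    have hdir : ∀ s ∈ C, ∀ t ∈ C, ∃ u ∈ C, s ≤ u ∧ t ≤ u := by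
      intro s hs t ht
      rcases hchain.total hs ht with h | h
      · exact ⟨t, ht, h, le_rfl⟩
      · exact ⟨s, hs, le_rfl, h⟩
    let t : Setoid (ℤ × ℤ) := {
      r := fun a b => ∃ s ∈ C, s a b
      iseqv := ⟨fun a => ⟨s₀, hs₀, s₀.refl a⟩, fun ⟨s, hs, h⟩ => ⟨s, hs, s.symm h⟩,
        fun ⟨s, hs, h⟩ ⟨t, ht, h'⟩ => by
          obtain ⟨u, hu, h1, h2⟩ := hdir s hs t ht
          exact ⟨u, hu, u.trans (h1 h) (h2 h')⟩⟩ }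
    refine ⟨t, ⟨?_, ?_, ?_, ?_⟩, ?_⟩
    · rintro a b ⟨s, hs, h⟩ m
      exact ⟨s, hs, (hC hs).add_shift h m⟩
    · rintro a b ⟨s, hs, h⟩
      refine ((hC hs).joined h).mono ?_
      exact fun c hc => ⟨s, hs, hc⟩
    · rintro a b ⟨s, hs, h⟩
      exact (hC hs).not_arrow h
    · rintro a m ⟨s, hs, h⟩
      exact (hC hs).eq_zero h
    · intro s hs a b h
      exact ⟨s, hs, h⟩
  have hbot : T.IsFreePartition F ⊥ := by
    refine ⟨?_, ?_, ?_, ?_⟩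
    · rintro a b (rfl : a = b) m
      exact rfl
    · rintro a b (rfl : a = b)
      exact .refl rfl
    · rintro a b (rfl : a = b)
      exact hfree a
    · intro a m (h : a = a + T.shift m)
      refine shift_injective (T := T) ?_
      rw [map_zero]
      exact (left_eq_add.1 h)
  obtain ⟨s, -, hs⟩ := zorn_le_nonempty₀ {s | T.IsFreePartition F s} hub ⊥ hbot
  refine ⟨s, hs.1, fun a c hac hne => ?_⟩
  by_contra! hcon
  obtain ⟨t, ht, hst, hact⟩ := IsFreePartition.exists_merge hs.1 hF hac hne hcon.1 hcon.2
  refine hne 0 ?_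
  rw [map_zero, add_zero]
  exact hs.2 ht hst hact

end PlaneTiling

theorem planeDet_add (u z w : ℂ) : planeDet u (z + w) = planeDet u z + planeDet u w := by
  simp only [planeDet, Complex.add_re, Complex.add_im]
  ring

theorem planeDet_sub (u z w : ℂ) : planeDet u (z - w) = planeDet u z - planeDet u w := by
  simp only [planeDet, Complex.sub_re, Complex.sub_im]
  ring

theorem planeDet_neg_left (u z : ℂ) : planeDet (-u) z = -planeDet u z := by
  simp only [planeDet, Complex.neg_re, Complex.neg_im]
  ring

theorem planeDet_smul (u z : ℂ) (r : ℝ) : planeDet u (r • z) = r * planeDet u z := by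
  simp only [planeDet, Complex.smul_re, Complex.smul_im, smul_eq_mul]
  ring

theorem continuous_planeDet (u : ℂ) : Continuous (planeDet u) := by
  unfold planeDet
  fun_prop

theorem abs_planeDet_le (u z : ℂ) : |planeDet u z| ≤ 2 * ‖u‖ * ‖z‖ := by
  have h1 := Complex.abs_re_le_norm u
  have h2 := Complex.abs_im_le_norm u
  have h3 := Complex.abs_re_le_norm z
  have h4 := Complex.abs_im_le_norm z
  unfold planeDet
  refine (abs_sub _ _).trans ?_
  rw [abs_mul, abs_mul]
  have h5 := mul_le_mul h1 h4 (abs_nonneg _) (norm_nonneg _)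
  have h6 := mul_le_mul h2 h3 (abs_nonneg _) (norm_nonneg _)
  linarith

theorem planeDet_ofReal_mul_self (u : ℂ) (s : ℝ) : planeDet u (s * u) = 0 := by
  simp only [planeDet, Complex.mul_re, Complex.mul_im, Complex.ofReal_re, Complex.ofReal_im]
  ring

/-- There are orbits progressing arbitrarily far in every direction. -/
def IsSpreading (G : ℂ ≃ₜ ℂ) : Prop :=
  ∀ u : ℂ, u ≠ 0 → ∀ C : ℝ, ∃ (x : ℂ) (n : ℕ), C < planeDet u (G^[n] x - x)

theorem IsSpreading.symm {G : ℂ ≃ₜ ℂ} (h : IsSpreading G) : IsSpreading G.symm := by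
  intro u hu C
  obtain ⟨x, n, hx⟩ := h (-u) (neg_ne_zero.2 hu) C
  refine ⟨G^[n] x, n, ?_⟩
  have h1 : G.symm^[n] (G^[n] x) = x :=
    Function.LeftInverse.iterate G.symm_apply_apply n x
  rw [h1, planeDet_sub]
  rw [planeDet_neg_left, planeDet_sub] at hx
  linarith

theorem latticePoint_ne_zero {m : ℤ × ℤ} (hm : m ≠ 0) : latticePoint m ≠ 0 := by
  intro h
  have h1 := congrArg Complex.re h
  have h2 := congrArg Complex.im h
  rw [latticePoint_re, Complex.zero_re, Int.cast_eq_zero] at h1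
  rw [latticePoint_im, Complex.zero_im, Int.cast_eq_zero] at h2
  exact hm (Prod.ext h1 h2)

/-- Every point can be moved near any other one by a lattice translation. -/
theorem exists_norm_add_latticePoint_sub_le (z w : ℂ) :
    ∃ m, ‖z + latticePoint m - w‖ ≤ 2 := by
  refine ⟨(⌊w.re - z.re⌋, ⌊w.im - z.im⌋), (Complex.norm_le_abs_re_add_abs_im _).trans ?_⟩
  rw [Complex.sub_re, Complex.sub_im, Complex.add_re, Complex.add_im, latticePoint_re,
    latticePoint_im]
  have h1 := Int.floor_le (w.re - z.re)
  have h2 := Int.lt_floor_add_one (w.re - z.re)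
  have h3 := Int.floor_le (w.im - z.im)
  have h4 := Int.lt_floor_add_one (w.im - z.im)
  have h5 : |z.re + ⌊w.re - z.re⌋ - w.re| ≤ 1 := by
    rw [abs_le]
    constructor <;> linarith
  have h6 : |z.im + ⌊w.im - z.im⌋ - w.im| ≤ 1 := by
    rw [abs_le]
    constructor <;> linarith
  linarith

theorem symm_add_latticePoint {F : ℂ ≃ₜ ℂ}
    (hF : ∀ z m, F (z + latticePoint m) = F z + latticePoint m) (z : ℂ) (m : ℤ × ℤ) :
    F.symm (z + latticePoint m) = F.symm z + latticePoint m := by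
  rw [F.symm_apply_eq, hF, F.apply_symm_apply]

section Trap

variable {u : ℂ} {C : ℝ} {γ : ℝ → ℂ}

theorem exists_planeDet_eq (hu : u ≠ 0) (r : ℝ) : ∃ z, planeDet u z = r := by
  have h : u.re ^ 2 + u.im ^ 2 ≠ 0 := fun h => hu <| Complex.ext
    (by rw [Complex.zero_re]; nlinarith [sq_nonneg u.re, sq_nonneg u.im])
    (by rw [Complex.zero_im]; nlinarith [sq_nonneg u.re, sq_nonneg u.im])
  refine ⟨⟨-(r / (u.re ^ 2 + u.im ^ 2) * u.im), r / (u.re ^ 2 + u.im ^ 2) * u.re⟩, ?_⟩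
  simp only [planeDet]
  field_simp
  ring

theorem abs_planeDet_le_of_norm_sub_le (hC : ∀ s : ℝ, ‖γ s - s * u‖ ≤ C) (s : ℝ) :
    |planeDet u (γ s)| ≤ 2 * ‖u‖ * C := by
  have h1 : planeDet u (γ s) = planeDet u (γ s - s * u) := by
    rw [planeDet_sub, planeDet_ofReal_mul_self, sub_zero]
  rw [h1]
  exact (abs_planeDet_le _ _).trans
    (mul_le_mul_of_nonneg_left (hC s) (by positivity))

theorem isPreconnected_setOf_planeDet_lt (u : ℂ) (r : ℝ) :
    IsPreconnected {z | planeDet u z < r} := by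
  refine Convex.isPreconnected fun z hz w hw a b ha hb hab => ?_
  change planeDet u _ < r
  rw [planeDet_add, planeDet_smul, planeDet_smul]
  change planeDet u z < r at hz
  change planeDet u w < r at hw
  rcases ha.eq_or_lt with rfl | ha
  · rw [zero_add] at hab
    rw [hab]
    linarith
  · have hr : r = a * r + b * r := by rw [← add_mul, hab, one_mul]
    nlinarith

theorem isClosed_range_of_norm_sub_le (hγ : Continuous γ) (hu : u ≠ 0)
    (hC : ∀ s : ℝ, ‖γ s - s * u‖ ≤ C) : IsClosed (Set.range γ) := by
  have hcl : IsClosedEmbedding fun s : ℝ => (s : ℂ) * u :=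
    (Homeomorph.mulRight₀ u hu).isClosedEmbedding.comp Complex.isometry_ofReal.isClosedEmbedding
  have h : Tendsto γ (cocompact ℝ) (cocompact ℂ) := by
    have h1 := tendsto_norm_cocompact_atTop.comp hcl.tendsto_cocompact
    rw [← Metric.cobounded_eq_cocompact (α := ℂ), ← comap_norm_atTop (E := ℂ), tendsto_comap_iff]
    refine tendsto_atTop_mono (fun s => ?_) (tendsto_atTop_add_const_right _ (-C) h1)
    have h2 := norm_sub_norm_le ((s : ℂ) * u) (γ s)
    rw [norm_sub_rev] at h2
    have h3 := hC s
    simp only [Function.comp]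
    linarith
  exact ((isProperMap_iff_tendsto_cocompact.2 ⟨hγ, h⟩).isClosedMap).isClosed_range

/-- The two sides of a curve following a straight line are different. -/
theorem not_joinedIn_compl_range (hγ : Continuous γ) (hu : u ≠ 0)
    (hC : ∀ s : ℝ, ‖γ s - s * u‖ ≤ C) {z w : ℂ} (hz : planeDet u z < -(2 * ‖u‖ * C))
    (hw : 2 * ‖u‖ * C < planeDet u w) : ¬ JoinedIn (Set.range γ)ᶜ z w := by
  intro h
  have hM := abs_planeDet_le_of_norm_sub_le hC
  obtain ⟨v, hv⟩ := exists_planeDet_eq hu 1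
  let f := h.somePath
  let e : ℝ → ℂ := fun t => f.extend t + ((min t 0 + max (t - 1) 0 : ℝ) : ℂ) * v
  have he : Continuous e := by
    have := f.continuous_extend
    fun_prop
  have hbd : ∃ D, ∀ t : ℝ, ‖e t - t * v‖ ≤ D := by
    obtain ⟨D, hD⟩ := (isCompact_univ (X := unitInterval)).exists_bound_of_continuousOn
      f.continuous.continuousOn
    refine ⟨D + ‖v‖, fun t => ?_⟩
    have e1 : e t - t * v = f.extend t + ((min t 0 + max (t - 1) 0 - t : ℝ) : ℂ) * v := by
      simp only [e]
      push_cast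
      ring
    have e2 : |min t 0 + max (t - 1) 0 - t| ≤ 1 := by
      rw [abs_le]
      rcases le_total t 0 with h0 | h0 <;> rcases le_total (t - 1) 0 with h1 | h1 <;>
        simp only [min_eq_left, min_eq_right, max_eq_left, max_eq_right, h0, h1] <;>
        constructor <;> linarith
    rw [e1]
    refine (norm_add_le _ _).trans (add_le_add ?_ ?_)
    · exact hD _ (Set.mem_univ _)
    · rw [norm_mul, Complex.norm_real, Real.norm_eq_abs]
      exact mul_le_of_le_one_left (norm_nonneg _) e2
  obtain ⟨D, hD⟩ := hbd
  obtain ⟨s, t, hst⟩ := exists_eq_of_transverse_directions hγ he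
    (by rw [hv]; exact one_ne_zero) hC hD
  have hdet : ∀ r : ℝ, planeDet u (r * v) = r := by
    intro r
    rw [← Complex.real_smul, planeDet_smul, hv, mul_one]
  have hs := abs_le.1 (hM s)
  rcases lt_or_ge t 0 with h0 | h0
  · have : e t = z + (t : ℂ) * v := by
      simp only [e]
      rw [f.extend_of_le_zero h0.le, min_eq_left h0.le, max_eq_right (by linarith), add_zero]
    rw [hst, this, planeDet_add, hdet] at hs
    linarith
  · rcases lt_or_ge 1 t with h1 | h1
    · have : e t = w + ((t - 1 : ℝ) : ℂ) * v := by
        simp only [e]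
        rw [f.extend_of_one_le h1.le, min_eq_right h0, max_eq_left (by linarith), zero_add]
      rw [hst, this, planeDet_add, hdet] at hs
      linarith
    · have : e t = f ⟨t, h0, h1⟩ := by
        simp only [e]
        rw [f.extend_apply ⟨h0, h1⟩, min_eq_right h0, max_eq_right (by linarith)]
        simp
      exact h.somePath_mem ⟨t, h0, h1⟩ ⟨s, hst.trans this⟩

/-- The image of a curve following a straight line under a spreading map reaches the side of
the curve containing a half plane. -/
theorem exists_mem_connectedComponentIn (hγ : Continuous γ) (hu : u ≠ 0)
    (hC : ∀ s : ℝ, ‖γ s - s * u‖ ≤ C) {F : ℂ ≃ₜ ℂ} (hB : HasBoundedDisplacement F)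
    (hF : ∀ z m, F (z + latticePoint m) = F z + latticePoint m) (hS : IsSpreading F) {z₀ : ℂ}
    (hz₀ : planeDet u z₀ < -(2 * ‖u‖ * C)) :
    ∃ s, F (γ s) ∈ connectedComponentIn (Set.range γ)ᶜ z₀ := by
  by_contra! hcon
  have hM := abs_planeDet_le_of_norm_sub_le hC
  set L := connectedComponentIn (Set.range γ)ᶜ z₀
  have hlow : {z | planeDet u z < -(2 * ‖u‖ * C)} ⊆ L := by
    refine (isPreconnected_setOf_planeDet_lt u _).subset_connectedComponentIn hz₀ ?_
    rintro _ hz ⟨s, rfl⟩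
    change planeDet u _ < _ at hz
    linarith [(abs_le.1 (hM s)).1]
  have hopen : IsOpen L := (isClosed_range_of_norm_sub_le hγ hu hC).isOpen_compl.connectedComponentIn
  have hLA : L ⊆ (Set.range γ)ᶜ := connectedComponentIn_subset _ _
  have hz₀A : z₀ ∈ (Set.range γ)ᶜ := hLA (hlow hz₀)
  have hconn : IsConnected L := isConnected_connectedComponentIn_iff.2 hz₀A
  have hpath : IsPathConnected L := hopen.isConnected_iff_isPathConnected.1 hconn
  have hhigh : ∀ z ∈ L, planeDet u z ≤ 2 * ‖u‖ * C := by
    intro z hz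
    by_contra! hz'
    exact not_joinedIn_compl_range hγ hu hC hz₀ hz'
      ((hpath.joinedIn _ (hlow hz₀) _ hz).mono hLA)
  obtain ⟨D, hD⟩ := hB.symm
  have hinv : ∀ z ∈ L, F.symm z ∈ L := by
    obtain ⟨y, hy⟩ := exists_planeDet_eq hu (-(2 * ‖u‖ * C) - 1 - 2 * ‖u‖ * D)
    have hD0 : 0 ≤ D := (norm_nonneg _).trans (hD 0)
    have hyL : y ∈ L := hlow (by
      change planeDet u y < _
      rw [hy]
      linarith [show 0 ≤ 2 * ‖u‖ * D by positivity])
    have hFy : F.symm y ∈ L := by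
      refine hlow ?_
      change planeDet u _ < _
      have h1 := (abs_planeDet_le u (F.symm y - y)).trans
        (mul_le_mul_of_nonneg_left (hD y) (by positivity))
      rw [planeDet_sub] at h1
      linarith [(abs_le.1 h1).2]
    have hsub : F.symm '' L ⊆ L := by
      have h2 := (hconn.isPreconnected.image _ F.symm.continuous.continuousOn).subset_connectedComponentIn
        (F := (Set.range γ)ᶜ) (Set.mem_image_of_mem _ hyL) ?_
      · rwa [← connectedComponentIn_eq hFy] at h2
      · rintro _ ⟨z, hz, rfl⟩ ⟨s, hs⟩
        refine hcon s ?_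
        rwa [hs, F.apply_symm_apply]
    exact fun z hz => hsub (Set.mem_image_of_mem _ hz)
  obtain ⟨x, n, hx⟩ := hS.symm u hu (2 * ‖u‖ * C - planeDet u z₀ + (2 * ‖u‖ * 2) * 2 + 1)
  obtain ⟨w, hw⟩ := exists_planeDet_eq hu (planeDet u z₀ - 2 * ‖u‖ * 2)
  obtain ⟨m, hm⟩ := exists_norm_add_latticePoint_sub_le x w
  have h1 := abs_le.1 ((abs_planeDet_le u _).trans
    (mul_le_mul_of_nonneg_left hm (show 0 ≤ 2 * ‖u‖ by positivity)))
  rw [planeDet_sub, hw] at h1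
  have hxL : x + latticePoint m ∈ L := hlow (by
    change planeDet u _ < _
    linarith)
  have hiter : ∀ k : ℕ, F.symm^[k] (x + latticePoint m) ∈ L := by
    intro k
    induction k with
    | zero => exact hxL
    | succ k ih =>
      rw [Function.iterate_succ_apply']
      exact hinv _ ih
  have hcomm : F.symm^[n] (x + latticePoint m) = F.symm^[n] x + latticePoint m := by
    refine (Function.Semiconj.iterate_right (f := fun z => z + latticePoint m)
      (fun z => (symm_add_latticePoint hF z m).symm) n x).symm
  have h2 := hhigh _ (hiter n)
  rw [hcomm, planeDet_add] at h2
  rw [planeDet_add] at h1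
  rw [planeDet_sub] at hx
  linarith

/-- A curve following a straight line meets its image under a spreading map. -/
theorem exists_apply_eq_of_isSpreading (hγ : Continuous γ) (hu : u ≠ 0)
    (hC : ∀ s : ℝ, ‖γ s - s * u‖ ≤ C) {F : ℂ ≃ₜ ℂ} (hB : HasBoundedDisplacement F)
    (hF : ∀ z m, F (z + latticePoint m) = F z + latticePoint m) (hS : IsSpreading F) :
    ∃ s t, F (γ s) = γ t := by
  by_contra! hcon
  obtain ⟨z, hz⟩ := exists_planeDet_eq hu (-(2 * ‖u‖ * C) - 1)
  obtain ⟨w, hw⟩ := exists_planeDet_eq hu (2 * ‖u‖ * C + 1)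
  obtain ⟨s, hs⟩ := exists_mem_connectedComponentIn hγ hu hC hB hF hS (z₀ := z) (by linarith)
  obtain ⟨t, ht⟩ := exists_mem_connectedComponentIn (γ := fun s => γ (-s)) (u := -u) (C := C)
    (by fun_prop) (neg_ne_zero.2 hu) (fun s => by simpa using hC (-s)) hB hF hS (z₀ := w)
    (by rw [planeDet_neg_left, norm_neg]; linarith)
  have hr : Set.range (fun s => γ (-s)) = Set.range γ :=
    (neg_surjective (G := ℝ)).range_comp γ
  rw [hr] at ht
  set A := (Set.range γ)ᶜ
  have hopen : IsOpen A := (isClosed_range_of_norm_sub_le hγ hu hC).isOpen_compl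
  have hpre : IsPreconnected (Set.range fun s => F (γ s)) :=
    isPreconnected_range (F.continuous.comp hγ)
  have hsub := hpre.subset_connectedComponentIn (F := A) ⟨s, rfl⟩ (by
    rintro _ ⟨r, rfl⟩ ⟨r', hr'⟩
    exact hcon r r' hr'.symm)
  have h1 := connectedComponentIn_eq hs
  have h2 := connectedComponentIn_eq ht
  have h3 := connectedComponentIn_eq (hsub ⟨-t, rfl⟩)
  have h4 : connectedComponentIn A z = connectedComponentIn A w := by rw [h1, h3, h2]
  have hzA : z ∈ A := connectedComponentIn_nonempty_iff.1 ⟨_, hs⟩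
  have hwA : w ∈ A := connectedComponentIn_nonempty_iff.1 ⟨_, ht⟩
  have hpath : IsPathConnected (connectedComponentIn A z) :=
    hopen.connectedComponentIn.isConnected_iff_isPathConnected.1
      (isConnected_connectedComponentIn_iff.2 hzA)
  refine not_joinedIn_compl_range hγ hu hC (z := z) (w := w) (by linarith) (by linarith)
    ((hpath.joinedIn _ (mem_connectedComponentIn hzA) _ ?_).mono (connectedComponentIn_subset _ _))
  rw [h4]
  exact mem_connectedComponentIn hwA

end Trap

namespace PlaneTiling

variable {T : PlaneTiling} {F : ℂ ≃ₜ ℂ}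

theorem add_latticePoint_mem_region {S S' : Set (ℤ × ℤ)} {m : ℤ × ℤ}
    (hS : ∀ x ∈ S, x + T.shift m ∈ S') {z : ℂ} (hz : z ∈ T.region S) :
    z + latticePoint m ∈ T.region S' := by
  have h1 : (fun z => z + latticePoint m) '' (⋃ a ∈ S, T.tile a) ⊆ ⋃ a ∈ S', T.tile a := by
    rintro _ ⟨w, hw, rfl⟩
    obtain ⟨a, ha, hwa⟩ := Set.mem_iUnion₂.1 hw
    refine Set.mem_biUnion (hS a ha) ?_
    simpa [T.tile_add_shift] using hwa
  exact interior_mono h1 ((isOpenMap_add_right _).image_interior_subset _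
    (Set.mem_image_of_mem _ hz))

/-- A periodic connected family of tiles contains a periodic curve. -/
theorem Joined.exists_curve {S : Set (ℤ × ℤ)} {a m : ℤ × ℤ} (h : T.Joined S a (a + T.shift m))
    (hS : ∀ x ∈ S, ∀ k : ℤ, x + T.shift (k • m) ∈ S) :
    ∃ γ : ℝ → ℂ, Continuous γ ∧ (∀ t, γ t ∈ T.region S) ∧
      ∃ C, ∀ s : ℝ, ‖γ s - s * latticePoint m‖ ≤ C := by
  have hj := h.joinedIn
  rw [T.center_add_shift] at hj
  let g := hj.somePath
  let h : ℝ → ℂ := fun t => g.extend t - t * latticePoint m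
  have hh : Continuous h := by
    have := g.continuous_extend
    fun_prop
  have hfr : Continuous fun t : ℝ => h (Int.fract t) :=
    hh.continuousOn.comp_fract'' (by simp [h])
  refine ⟨fun t => h (Int.fract t) + t * latticePoint m, hfr.add (by fun_prop), fun t => ?_, ?_⟩
  · have e : h (Int.fract t) + t * latticePoint m =
        g.extend (Int.fract t) + latticePoint (⌊t⌋ • m) := by
      simp only [h]
      rw [map_zsmul, zsmul_eq_mul]
      have := Int.fract_add_floor t
      nth_rewrite 3 [← this]
      push_cast
      ring
    change h (Int.fract t) + t * latticePoint m ∈ _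
    rw [e]
    refine add_latticePoint_mem_region (fun x hx => hS x hx _) ?_
    rw [g.extend_apply ⟨Int.fract_nonneg t, (Int.fract_lt_one t).le⟩]
    exact hj.somePath_mem _
  · obtain ⟨C, hC⟩ := (isCompact_Icc (a := (0 : ℝ)) (b := 1)).exists_bound_of_continuousOn
      hh.continuousOn
    refine ⟨C, fun s => ?_⟩
    rw [add_sub_cancel_right]
    exact hC _ ⟨Int.fract_nonneg s, (Int.fract_lt_one s).le⟩

/-- A periodic connected family of tiles contains an arrow. -/
theorem Joined.exists_arrow {S : Set (ℤ × ℤ)} {a m : ℤ × ℤ} (h : T.Joined S a (a + T.shift m))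
    (hS : ∀ x ∈ S, ∀ k : ℤ, x + T.shift (k • m) ∈ S) (hm : m ≠ 0)
    (hB : HasBoundedDisplacement F)
    (hF : ∀ z m, F (z + latticePoint m) = F z + latticePoint m) (hSp : IsSpreading F) :
    ∃ b ∈ S, ∃ c ∈ S, T.Arrow F b c := by
  obtain ⟨γ, hγ, hγS, C, hC⟩ := h.exists_curve hS
  obtain ⟨s, t, hst⟩ := exists_apply_eq_of_isSpreading hγ (latticePoint_ne_zero hm) hC hB hF hSp
  exact arrow_of_mem_region (hγS s) (hst ▸ hγS t)

end PlaneTiling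

namespace PlaneTiling

variable {T : PlaneTiling} {F : ℂ ≃ₜ ℂ} {s : Setoid (ℤ × ℤ)}

/-- A free partition for a spreading fixed point free map, whose neighbouring classes are
comparable. -/
structure IsSpreadingPartition (T : PlaneTiling) (F : ℂ ≃ₜ ℂ) (s : Setoid (ℤ × ℤ)) : Prop
    extends T.IsFreePartition F s where
  leads_or : ∀ a c, T.Touch a c → (∀ m, ¬ s a (c + T.shift m)) →
    T.Leads F s a c ∨ T.Leads F s c a
  apply_add : ∀ z m, F (z + latticePoint m) = F z + latticePoint m
  bounded : HasBoundedDisplacement F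
  spreading : IsSpreading F
  apply_ne : ∀ z, F z ≠ z

theorem IsSpreadingPartition.symm (h : T.IsSpreadingPartition F s) :
    T.IsSpreadingPartition F.symm s where
  toIsFreePartition := h.toIsFreePartition.symm
  leads_or a c hac hne := by
    rw [leads_symm_iff, leads_symm_iff]
    exact (h.leads_or a c hac hne).symm
  apply_add := symm_add_latticePoint h.apply_add
  bounded := h.bounded.symm
  spreading := h.spreading.symm
  apply_ne z hz := h.apply_ne z (by rw [F.symm_apply_eq] at hz; exact hz.symm)

/-- A positive iterate of the region of the class of `a` meets the class of `b`, or they agree. -/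
def Reach (T : PlaneTiling) (F : ℂ ≃ₜ ℂ) (s : Setoid (ℤ × ℤ)) (a b : ℤ × ℤ) : Prop :=
  s a b ∨ Relation.TransGen (T.Leads F s) a b

/-- The tiles reached from the translates of `a`. -/
def future (T : PlaneTiling) (F : ℂ ≃ₜ ℂ) (s : Setoid (ℤ × ℤ)) (a : ℤ × ℤ) : Set (ℤ × ℤ) :=
  {b | ∃ m, T.Reach F s (a + T.shift m) b}

/-- The tiles met by the image of the class of `a`. -/
def imageTiles (T : PlaneTiling) (F : ℂ ≃ₜ ℂ) (s : Setoid (ℤ × ℤ)) (a : ℤ × ℤ) :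
    Set (ℤ × ℤ) :=
  {b | ∃ x, s a x ∧ T.Arrow F x b}

theorem transGen_leads_congr {a b a' b' : ℤ × ℤ} (h : Relation.TransGen (T.Leads F s) a b)
    (ha : s a a') (hb : s b b') : Relation.TransGen (T.Leads F s) a' b' := by
  have h1 : Relation.TransGen (T.Leads F s) a b' := by
    cases h with
    | single h => exact .single (h.congr (s.refl _) hb)
    | tail h h' => exact h.tail (h'.congr (s.refl _) hb)
  obtain ⟨c, h2, h3⟩ := Relation.TransGen.head'_iff.1 h1
  exact .head' (h2.congr ha (s.refl _)) h3

theorem Reach.trans_transGen {a b c : ℤ × ℤ} (h : T.Reach F s a b)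
    (h' : Relation.TransGen (T.Leads F s) b c) : Relation.TransGen (T.Leads F s) a c := by
  rcases h with h | h
  · exact transGen_leads_congr h' (s.symm h) (s.refl _)
  · exact h.trans h'

theorem transGen_trans_reach {a b c : ℤ × ℤ} (h : Relation.TransGen (T.Leads F s) a b)
    (h' : T.Reach F s b c) : Relation.TransGen (T.Leads F s) a c := by
  rcases h' with h' | h'
  · exact transGen_leads_congr h (s.refl _) h'
  · exact h.trans h'

theorem Reach.trans {a b c : ℤ × ℤ} (h : T.Reach F s a b) (h' : T.Reach F s b c) :
    T.Reach F s a c := by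
  rcases h' with h' | h'
  · rcases h with h | h
    · exact Or.inl (s.trans h h')
    · exact Or.inr (transGen_leads_congr h (s.refl _) h')
  · exact Or.inr (h.trans_transGen h')

theorem Leads.reach {a b : ℤ × ℤ} (h : T.Leads F s a b) : T.Reach F s a b := Or.inr (.single h)

theorem transGen_leads_symm {a b : ℤ × ℤ} (h : Relation.TransGen (T.Leads F s) a b) :
    Relation.TransGen (T.Leads F.symm s) b a :=
  Relation.TransGen.mono (fun _ _ h => leads_symm_iff.2 h) _ _ (Relation.transGen_swap.2 h)

theorem Reach.symm {a b : ℤ × ℤ} (h : T.Reach F.symm s a b) : T.Reach F s b a := by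
  rcases h with h | h
  · exact Or.inl (s.symm h)
  · exact Or.inr (transGen_leads_symm h)

theorem self_mem_future (a : ℤ × ℤ) : a ∈ T.future F s a :=
  ⟨0, Or.inl (by rw [map_zero, add_zero])⟩

theorem mem_future_of_reach {a b c : ℤ × ℤ} (h : b ∈ T.future F s a) (h' : T.Reach F s b c) :
    c ∈ T.future F s a := by
  obtain ⟨m, hm⟩ := h
  exact ⟨m, hm.trans h'⟩

theorem imageTiles_subset_future (a : ℤ × ℤ) : T.imageTiles F s a ⊆ T.future F s a := by
  rintro b ⟨x, hx, hxb⟩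
  exact mem_future_of_reach (self_mem_future a) (Leads.reach ⟨x, b, hx, s.refl b, hxb⟩)

theorem exists_arrow (F : ℂ ≃ₜ ℂ) (a : ℤ × ℤ) : ∃ b, T.Arrow F a b := by
  obtain ⟨z, hz⟩ := T.tile_nonempty a
  obtain ⟨b, hb, -⟩ := exists_arrow_mem_tile (F := F) hz
  exact ⟨b, hb⟩

/-- A chain of tiles leaving a set does so at some place. -/
theorem Joined.exists_touch {S P : Set (ℤ × ℤ)} {a b : ℤ × ℤ} (h : T.Joined S a b) (ha : a ∈ P)
    (hb : b ∉ P) : ∃ x ∈ P, ∃ y ∈ S, y ∉ P ∧ T.Touch x y := by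
  obtain ⟨-, h⟩ := h
  induction h with
  | refl => exact absurd ha hb
  | @tail x y _ h ih =>
    by_cases hx : x ∈ P
    · exact ⟨x, hx, y, h.1, hb, h.2⟩
    · exact ih hx

namespace IsFreePartition

theorem joined_imageTiles (h : T.IsFreePartition F s) {a b c : ℤ × ℤ}
    (hb : b ∈ T.imageTiles F s a) (hc : c ∈ T.imageTiles F s a) :
    T.Joined (T.imageTiles F s a) b c := by
  obtain ⟨x, hx, hxb⟩ := hb
  obtain ⟨y, hy, hyc⟩ := hc
  have hxy := h.joined (s.trans (s.symm hx) hy)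
  obtain ⟨-, hxy⟩ := hxy
  clear hy
  induction hxy generalizing c with
  | refl =>
    refine ((Touch.refl x).joined_image (Or.inl hxb) (Or.inl hyc)).mono ?_
    rintro d (hd | hd) <;> exact ⟨x, hx, hd⟩
  | @tail u v huv h' ih =>
    obtain ⟨d, hd⟩ := exists_arrow (T := T) F u
    have hu : s x u := Joined.right_mem ⟨s.refl x, huv⟩
    refine (ih hd).trans ((h'.2.joined_image (Or.inl hd) (Or.inr hyc)).mono ?_)
    rintro e (he | he)
    · exact ⟨u, s.trans hx hu, he⟩
    · exact ⟨v, s.trans hx h'.1, he⟩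

theorem joined_future_of_rel (h : T.IsFreePartition F s) {a b c : ℤ × ℤ}
    (hb : b ∈ T.future F s a) (hbc : s b c) : T.Joined (T.future F s a) b c :=
  (h.joined hbc).mono fun _ hd => mem_future_of_reach hb (Or.inl hd)

theorem joined_of_leads (h : T.IsFreePartition F s) {a b c : ℤ × ℤ} (hb : T.Leads F s a b)
    (hc : T.Leads F s a c) : T.Joined (T.future F s a) b c := by
  have hb' := mem_future_of_reach (self_mem_future a) hb.reach
  have hc' := mem_future_of_reach (self_mem_future a) hc.reach
  obtain ⟨x, b', hx, hbb, hxb⟩ := hb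
  obtain ⟨y, c', hy, hcc, hyc⟩ := hc
  exact ((h.joined_future_of_rel hb' hbb).trans
    ((h.joined_imageTiles ⟨x, hx, hxb⟩ ⟨y, hy, hyc⟩).mono (imageTiles_subset_future a))).trans
    (h.joined_future_of_rel hc' hcc).symm

end IsFreePartition

namespace IsSpreadingPartition

theorem transGen_add_shift (h : T.IsSpreadingPartition F s) {a b : ℤ × ℤ}
    (hab : Relation.TransGen (T.Leads F s) a b) (m : ℤ × ℤ) :
    Relation.TransGen (T.Leads F s) (a + T.shift m) (b + T.shift m) :=
  hab.lift (fun x => x + T.shift m) fun _ _ hxy => h.leads_add_shift h.apply_add hxy m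

theorem reach_add_shift (h : T.IsSpreadingPartition F s) {a b : ℤ × ℤ}
    (hab : T.Reach F s a b) (m : ℤ × ℤ) :
    T.Reach F s (a + T.shift m) (b + T.shift m) :=
  hab.imp (fun hab => h.add_shift hab m) fun hab => h.transGen_add_shift hab m

theorem add_shift_mem_future (h : T.IsSpreadingPartition F s) {a b : ℤ × ℤ}
    (hb : b ∈ T.future F s a) (m : ℤ × ℤ) : b + T.shift m ∈ T.future F s a := by
  obtain ⟨k, hk⟩ := hb
  refine ⟨k + m, ?_⟩
  rw [map_add, ← add_assoc]
  exact h.reach_add_shift hk m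

theorem future_subset (h : T.IsSpreadingPartition F s) {a b : ℤ × ℤ}
    (hb : b ∈ T.future F s a) : T.future F s b ⊆ T.future F s a := by
  rintro c ⟨m, hm⟩
  exact mem_future_of_reach (h.add_shift_mem_future hb m) hm

/-- The future of a class touching one of its translates is joined to it. -/
theorem exists_leads_joined_of_touch_shift (h : T.IsSpreadingPartition F s) {a x c m : ℤ × ℤ}
    (hx : s a x) (hxc : T.Touch x c) (hc : s (a + T.shift m) c) (hm : m ≠ 0) :
    ∃ b, T.Leads F s a b ∧ T.Joined (T.future F s a) a b := by
  let S : Set (ℤ × ℤ) := {y | ∃ k : ℤ, s (a + T.shift (k • m)) y}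
  have hSa : ∀ {y}, s a y → y ∈ S := fun {y} hy => ⟨0, by rwa [zero_smul, map_zero, add_zero]⟩
  have hSper : ∀ y ∈ S, ∀ k : ℤ, y + T.shift (k • m) ∈ S := by
    rintro y ⟨l, hl⟩ k
    refine ⟨l + k, ?_⟩
    rw [add_smul, map_add, ← add_assoc]
    exact h.add_shift hl _
  have hcS : c ∈ S := ⟨1, by rwa [one_smul]⟩
  have hSF : S ⊆ T.future F s a := fun y ⟨k, hk⟩ => ⟨k • m, Or.inl hk⟩
  have hcl : ∀ {y w}, y ∈ S → s y w → T.Joined S y w := by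
    rintro y w ⟨k, hk⟩ hyw
    refine (h.joined hyw).mono ?_
    exact fun v hv => ⟨k, s.trans hk hv⟩
  have hj : T.Joined S a (a + T.shift m) :=
    ((hcl (hSa (s.refl a)) hx).trans (hxc.joined (hSa hx) hcS)).trans (hcl hcS (s.symm hc))
  have hall : ∀ k : ℤ, T.Joined S a (a + T.shift (k • m)) := by
    have hstep : ∀ k : ℤ, T.Joined S (a + T.shift (k • m)) (a + T.shift ((k + 1) • m)) := by
      intro k
      have := hj.add_shift (S' := S) (k • m) fun y hy => hSper y hy k
      rwa [add_assoc a, ← map_add, ← one_smul ℤ m, smul_smul, mul_one, ← add_smul, add_comm 1 k]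
        at this
    intro k
    induction k with
    | zero =>
      rw [zero_smul, map_zero, add_zero]
      exact .refl (hSa (s.refl a))
    | succ k ih => exact ih.trans (hstep k)
    | pred k ih =>
      have := hstep (-k - 1)
      rw [sub_add_cancel] at this
      exact ih.trans this.symm
  obtain ⟨y, hy, w, hw, hyw⟩ := hj.exists_arrow hSper hm h.bounded h.apply_add h.spreading
  obtain ⟨k, hk⟩ := hy
  have hk' := h.add_shift hk (-(k • m))
  rw [map_neg, add_neg_cancel_right] at hk'
  have hyw' := hyw.add_shift h.apply_add (-(k • m))
  rw [map_neg] at hyw'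
  have hwS := hSper w hw (-k)
  rw [neg_smul, map_neg] at hwS
  refine ⟨_, ⟨_, _, hk', s.refl _, hyw'⟩, Joined.mono hSF ?_⟩
  obtain ⟨l, hl⟩ := hwS
  exact (hall l).trans (hcl ⟨l, s.refl _⟩ hl)

/-- Some class meeting the image of a class is joined to it in its future. -/
theorem exists_leads_joined (h : T.IsSpreadingPartition F s) (a : ℤ × ℤ) :
    ∃ b, T.Leads F s a b ∧ T.Joined (T.future F s a) a b := by
  by_contra! hcon
  have hno : ∀ x c, s a x → T.Touch x c → ¬ T.Leads F s a c := by
    intro x c hx hxc hac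
    have hxF := mem_future_of_reach (self_mem_future (T := T) (F := F) (s := s) a) (Or.inl hx)
    exact hcon c hac ((h.joined_future_of_rel (self_mem_future a) hx).trans
      (hxc.joined hxF (mem_future_of_reach (self_mem_future a) hac.reach)))
  let N : Set (ℤ × ℤ) := {c | ∃ x, s a x ∧ T.Touch x c ∧ ¬ s a c}
  have hNfin : N.Finite := by
    refine ((h.finite_class a).biUnion fun x _ => T.finite_touch x).subset ?_
    rintro c ⟨x, hx, hxc, -⟩
    exact Set.mem_biUnion hx hxc
  have hback : ∀ c ∈ N, T.Leads F s c a := by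
    rintro c ⟨x, hx, hxc, hc⟩
    have hne : ∀ m, ¬ s x (c + T.shift m) := by
      intro m hm
      have h1 := h.add_shift (s.trans hx hm) (-m)
      rw [map_neg, add_neg_cancel_right, ← map_neg] at h1
      obtain ⟨b, hb, hb'⟩ := h.exists_leads_joined_of_touch_shift hx hxc h1 fun h0 => hc (by
        rwa [h0, map_zero, add_zero] at h1)
      exact hcon b hb hb'
    rcases h.leads_or x c hxc hne with h1 | h1
    · exact absurd (h1.congr (s.symm hx) (s.refl c)) (hno x c hx hxc)
    · exact h1.congr (s.refl c) (s.symm hx)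
  have hnext : ∀ c ∈ N, ∃ d ∈ N, T.Leads F s c d := by
    intro c hc
    obtain ⟨y, b, hy, hb, hyb⟩ := hback c hc
    obtain ⟨x, hx, ⟨z, hzx, hzc⟩, hac⟩ := hc
    by_cases hall : ∀ e ∈ T.imageTiles F s c, s a e
    · obtain ⟨e, he, hze⟩ := exists_arrow_mem_tile (F := F) hzc
      obtain ⟨d, hd, hzd⟩ := exists_arrow_mem_tile (F := F) hzx
      exact absurd ⟨x, d, hx, s.refl d, hd⟩
        (hno e d (hall e ⟨c, s.refl c, he⟩) ⟨F z, hze, hzd⟩)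
    · push Not at hall
      obtain ⟨e, he, hae⟩ := hall
      obtain ⟨v, hv, d, ⟨w, hw, hwd⟩, hd, hvd⟩ :=
        (h.joined_imageTiles ⟨y, hy, hyb⟩ he).exists_touch (P := {v | s a v}) hb hae
      exact ⟨d, ⟨v, hv, hvd, hd⟩, w, d, hw, s.refl d, hwd⟩
  have hNne : N.Nonempty := by
    obtain ⟨b, hb⟩ := exists_arrow (T := T) F a
    obtain ⟨v, hv, d, -, hd, hvd⟩ := (joined_of_isPreconnected (T := T) isPreconnected_univ
      (Y := Set.univ) (fun z _ => by simpa using T.exists_mem_tile z)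
      (fun b _ => by simpa using T.tile_nonempty b) (Set.mem_univ a)
      (Set.mem_univ b)).exists_touch (P := {v | s a v}) (s.refl a) fun hab => h.not_arrow hab hb
    exact ⟨d, v, hv, hvd, hd⟩
  have : Finite N := hNfin
  let r : N → N → Prop := fun x y => Relation.TransGen (T.Leads F s) y x
  have : IsTrans N r := ⟨fun _ _ _ hxy hyz => hyz.trans hxy⟩
  have : Std.Irrefl r := ⟨fun x => h.not_transGen h.bounded h.apply_ne x⟩
  obtain ⟨x, -, hx⟩ := (Finite.wellFounded_of_trans_of_irrefl r).has_min Set.univ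
    ⟨⟨_, hNne.some_mem⟩, Set.mem_univ _⟩
  obtain ⟨y, hy, hxy⟩ := hnext x x.2
  exact hx ⟨y, hy⟩ (Set.mem_univ _) (.single hxy)

theorem joined_future (h : T.IsSpreadingPartition F s) {a b : ℤ × ℤ}
    (hab : Relation.TransGen (T.Leads F s) a b) : T.Joined (T.future F s a) a b := by
  have hone : ∀ {x y}, T.Leads F s x y → T.Joined (T.future F s x) x y := by
    intro x y hxy
    obtain ⟨c, hc, hc'⟩ := h.exists_leads_joined x
    exact hc'.trans (h.joined_of_leads hc hxy)
  induction hab with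
  | single hab => exact hone hab
  | tail _ hbc ih => exact ih.trans ((hone hbc).mono (h.future_subset ih.right_mem))

end IsSpreadingPartition

end PlaneTiling

/-- A sequence with bounded increments which does not increase between equal labels increases
boundedly. -/
theorem le_add_card_mul {ι : Type*} [DecidableEq ι] (r : ℕ → ι) (h : ℕ → ℝ) {D : ℝ} (hD : 0 ≤ D)
    (hstep : ∀ j, h (j + 1) ≤ h j + D) (hr : ∀ i j, i < j → r i = r j → h j ≤ h i)
    (t : Finset ι) {i n : ℕ} (hin : i ≤ n) (ht : ∀ j, i ≤ j → j ≤ n → r j ∈ t) :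
    h n ≤ h i + t.card * D := by
  induction hk : t.card generalizing t i with
  | zero =>
    have := ht i le_rfl hin
    rw [Finset.card_eq_zero.1 hk] at this
    simp at this
  | succ k ih =>
    let j := Nat.findGreatest (fun j => i ≤ j ∧ r j = r i) n
    have hj : i ≤ j ∧ r j = r i :=
      Nat.findGreatest_spec (P := fun j => i ≤ j ∧ r j = r i) hin ⟨le_rfl, rfl⟩
    have hjn : j ≤ n := Nat.findGreatest_le n
    have hji : h j ≤ h i := by
      rcases hj.1.eq_or_lt with h0 | h0
      · rw [← h0]
      · exact hr i j h0 hj.2.symm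
    push_cast
    rcases hjn.eq_or_lt with h0 | h0
    · rw [h0] at hji
      have : 0 ≤ (k : ℝ) * D := by positivity
      linarith
    · have h1 := ih (t.erase (r i)) (i := j + 1) h0 (fun l hl hln => ?_) ?_
      · linarith [hstep j]
      · refine Finset.mem_erase.2 ⟨fun hl' => ?_, ht l (by omega) hln⟩
        exact Nat.findGreatest_is_greatest (P := fun j => i ≤ j ∧ r j = r i) (n := n) (k := l)
          hl hln ⟨by omega, hl'⟩
      · rw [Finset.card_erase_of_mem (ht i le_rfl hin), hk, Nat.add_sub_cancel]

/-- A set of lattice vectors closed under addition and not contained in a closed half plane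
contains the origin. -/
theorem zero_mem_of_add_mem {S : Set (ℤ × ℤ)} (hadd : ∀ m ∈ S, ∀ n ∈ S, m + n ∈ S)
    (hS : ∀ u : ℂ, u ≠ 0 → ∃ m ∈ S, 0 < planeDet u (latticePoint m)) : (0 : ℤ × ℤ) ∈ S := by
  by_contra h0
  have hsmul : ∀ m ∈ S, ∀ k : ℕ, 0 < k → k • m ∈ S := by
    intro m hm k hk
    induction k, hk using Nat.le_induction with
    | base => simpa using hm
    | succ k _ ih =>
      rw [succ_nsmul]
      exact hadd _ ih _ hm
  have hzsmul : ∀ m ∈ S, ∀ k : ℤ, 0 < k → k • m ∈ S := by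
    intro m hm k hk
    have := hsmul m hm k.toNat (by omega)
    rwa [← natCast_zsmul, Int.toNat_of_nonneg hk.le] at this
  obtain ⟨a, ha, -⟩ := hS 1 one_ne_zero
  have ha0 : a ≠ 0 := fun h => h0 (h ▸ ha)
  have hapos : 0 < a.1 ^ 2 + a.2 ^ 2 := by
    rcases eq_or_ne a.1 0 with h1 | h1
    · have h2 : a.2 ≠ 0 := fun h2 => ha0 (Prod.ext h1 h2)
      positivity
    · positivity
  let det : ℤ × ℤ → ℤ := fun m => a.1 * m.2 - a.2 * m.1
  let dot : ℤ × ℤ → ℤ := fun m => a.1 * m.1 + a.2 * m.2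
  have hpar : ∀ m ∈ S, det m = 0 → 0 < dot m := by
    intro m hm hdet
    have e1 : (a.1 ^ 2 + a.2 ^ 2) • m = dot m • a := by
      refine Prod.ext ?_ ?_
      · simp only [Prod.smul_fst, smul_eq_mul, dot]
        linear_combination (-a.2) * hdet
      · simp only [Prod.smul_snd, smul_eq_mul, dot]
        linear_combination a.1 * hdet
    by_contra! hle
    have h1 := hzsmul m hm _ hapos
    rcases hle.eq_or_lt with h2 | h2
    · rw [e1, h2, zero_smul] at h1
      exact h0 h1
    · have h3 := hadd _ h1 _ (hzsmul a ha (-dot m) (by omega))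
      rw [e1, ← add_smul, add_neg_cancel, zero_smul] at h3
      exact h0 h3
  have hcomp : ∀ m ∈ S, ∀ n ∈ S, 0 < det m → det n < 0 → 0 < det m * dot n - det n * dot m := by
    intro m hm n hn hdm hdn
    have h1 := hadd _ (hzsmul m hm (-det n) (by omega)) _ (hzsmul n hn (det m) hdm)
    have h2 := hpar _ h1 (by
      simp only [det, Prod.fst_add, Prod.snd_add, Prod.smul_fst, Prod.smul_snd, smul_eq_mul]
      ring)
    have e : dot (-det n • m + det m • n) = det m * dot n - det n * dot m := by
      simp only [dot, Prod.fst_add, Prod.snd_add, Prod.smul_fst, Prod.smul_snd, smul_eq_mul]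
      ring
    rwa [e] at h2
  have hpd : ∀ m n : ℤ × ℤ, planeDet (latticePoint m) (latticePoint n) = m.1 * n.2 - m.2 * n.1 := by
    intro m n
    simp only [planeDet, latticePoint_re, latticePoint_im]
  have hla := latticePoint_ne_zero ha0
  obtain ⟨p, hp, hp'⟩ := hS _ hla
  obtain ⟨n, hn, hn'⟩ := hS _ (neg_ne_zero.2 hla)
  rw [hpd] at hp'
  rw [planeDet_neg_left, hpd] at hn'
  have hdp : 0 < det p := by exact_mod_cast hp'
  have hdn : det n < 0 := by
    have : (0 : ℝ) < -(det n : ℤ) := by exact_mod_cast hn'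
    exact_mod_cast neg_pos.1 this
  let V : Set ℝ := {x | ∃ m ∈ S, det m < 0 ∧ x = dot m / det m}
  have hle : ∀ m ∈ S, 0 < det m → ∀ x ∈ V, x ≤ dot m / det m := by
    rintro m hm hdm x ⟨k, hk, hdk, rfl⟩
    have h1 : (0 : ℝ) < det m * dot k - det k * dot m := by
      exact_mod_cast hcomp m hm k hk hdm hdk
    have h2 : (0 : ℝ) < det m := by exact_mod_cast hdm
    have h3 : (det k : ℝ) < 0 := by exact_mod_cast hdk
    rw [le_div_iff₀ h2, div_mul_eq_mul_div, div_le_iff_of_neg h3]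
    linarith
  have hVne : V.Nonempty := ⟨_, n, hn, hdn, rfl⟩
  have hVbdd : BddAbove V := ⟨_, hle p hp hdp⟩
  set κ := sSup V
  obtain ⟨m, hm, hm'⟩ := hS ⟨κ * a.1 - a.2, κ * a.2 + a.1⟩ (by
    intro h
    have h1 := congrArg Complex.re h
    have h2 := congrArg Complex.im h
    simp only [Complex.zero_re, Complex.zero_im] at h1 h2
    have h3 : (0 : ℝ) < a.1 ^ 2 + a.2 ^ 2 := by exact_mod_cast hapos
    have h4 : (a.1 ^ 2 + a.2 ^ 2 : ℝ) = a.1 * (κ * a.2 + a.1) - a.2 * (κ * a.1 - a.2) := by ring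
    rw [h4, h1, h2] at h3
    simp at h3)
  have e : planeDet ⟨κ * a.1 - a.2, κ * a.2 + a.1⟩ (latticePoint m) =
      κ * (det m : ℤ) - (dot m : ℤ) := by
    simp only [planeDet, latticePoint_re, latticePoint_im, det, dot]
    push_cast
    ring
  rw [e] at hm'
  rcases lt_trichotomy (det m) 0 with h1 | h1 | h1
  · have h2 := le_csSup hVbdd ⟨m, hm, h1, rfl⟩
    have h3 : (det m : ℝ) < 0 := by exact_mod_cast h1
    rw [div_le_iff_of_neg h3] at h2
    linarith
  · have h2 : (0 : ℝ) < dot m := by exact_mod_cast hpar m hm h1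
    rw [h1, Int.cast_zero, mul_zero] at hm'
    linarith
  · have h2 := csSup_le hVne (hle m hm h1)
    have h3 : (0 : ℝ) < det m := by exact_mod_cast h1
    rw [le_div_iff₀ h3] at h2
    linarith

namespace PlaneTiling.IsSpreadingPartition

variable {T : PlaneTiling} {F : ℂ ≃ₜ ℂ} {s : Setoid (ℤ × ℤ)}

/-- In every direction some class leads to one of its translates. -/
theorem exists_transGen_shift (h : T.IsSpreadingPartition F s) {δ : ℝ}
    (hδ : ∀ a, ∀ z ∈ T.tile a, ∀ w ∈ T.tile a, ‖z - w‖ < δ) {u : ℂ} (hu : u ≠ 0) :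
    ∃ a m, Relation.TransGen (T.Leads F s) a (a + T.shift m) ∧
      0 < planeDet u (latticePoint m) := by
  obtain ⟨K, hK⟩ := T.exists_finset
  choose res hres using hK
  obtain ⟨D, hD⟩ := h.bounded
  have hD0 : 0 ≤ D := (norm_nonneg _).trans (hD 0)
  have hδ0 : 0 < δ := (norm_nonneg _).trans_lt (hδ 0 _ (core_subset_tile _ (T.center_mem_core 0)) _
    (core_subset_tile _ (T.center_mem_core 0)))
  by_contra! hcon
  set E := 2 * ‖u‖ * (D + 2 * δ)
  obtain ⟨x, n, hx⟩ := h.spreading u hu (K.card * E + 2 * (2 * ‖u‖ * δ))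
  choose next hnext1 hnext2 using fun (a : ℤ × ℤ) (z : T.tile a) =>
    exists_arrow_mem_tile (F := F) z.2
  obtain ⟨b₀, hb₀⟩ := T.exists_mem_tile x
  have hwalk : ∃ b : ℕ → ℤ × ℤ, (∀ i, F^[i] x ∈ T.tile (b i)) ∧
      ∀ i, T.Arrow F (b i) (b (i + 1)) := by
    let B : ℕ → {p : (ℤ × ℤ) × ℂ // p.2 ∈ T.tile p.1} := fun i => Nat.rec ⟨(b₀, x), hb₀⟩
      (fun _ p => ⟨(next p.1.1 ⟨p.1.2, p.2⟩, F p.1.2), hnext2 p.1.1 ⟨p.1.2, p.2⟩⟩) i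
    have hB : ∀ i, (B i).1.2 = F^[i] x := by
      intro i
      induction i with
      | zero => rfl
      | succ i ih =>
        rw [Function.iterate_succ_apply', ← ih]
    exact ⟨fun i => (B i).1.1, fun i => hB i ▸ (B i).2, fun i => hnext1 _ _⟩
  obtain ⟨b, hb, harr⟩ := hwalk
  let ht : ℕ → ℝ := fun i => planeDet u (T.center (b i))
  have hclose : ∀ i, |planeDet u (T.center (b i) - F^[i] x)| ≤ 2 * ‖u‖ * δ := fun i =>
    (abs_planeDet_le _ _).trans (mul_le_mul_of_nonneg_left
      (hδ _ _ (core_subset_tile _ (T.center_mem_core _)) _ (hb i)).le (by positivity))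
  have hlead : ∀ i j, i < j → Relation.TransGen (T.Leads F s) (b i) (b j) := by
    intro i j hij
    induction j, hij using Nat.le_induction with
    | base => exact .single (harr i).leads
    | succ j _ ih => exact ih.tail (harr j).leads
  have hbound := le_add_card_mul (fun i => b i + T.shift (res (b i))) ht (D := E)
    (by positivity) (fun j => ?_) (fun i j hij hr => ?_) K (Nat.zero_le n) fun j _ _ => hres _
  · have h1 := abs_le.1 (hclose 0)
    have h2 := abs_le.1 (hclose n)
    rw [planeDet_sub] at h1 h2 hx
    simp only [ht] at hbound
    rw [Function.iterate_zero_apply] at h1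
    linarith
  · have h1 := abs_le.1 (hclose j)
    have h2 := abs_le.1 (hclose (j + 1))
    have h3 := abs_le.1 ((abs_planeDet_le u _).trans
      (mul_le_mul_of_nonneg_left (hD (F^[j] x)) (by positivity)))
    rw [← Function.iterate_succ_apply' F] at h3
    rw [planeDet_sub] at h1 h2 h3
    simp only [ht, E]
    linarith
  · have e : b j = b i + T.shift (res (b i) - res (b j)) := by
      rw [map_sub, ← add_sub_assoc, eq_sub_iff_add_eq]
      exact hr.symm
    have h1 := hcon (b i) (res (b i) - res (b j)) (e ▸ hlead i j hij)
    simp only [ht]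
    rw [e, T.center_add_shift, planeDet_add]
    linarith

/-- Classes leading to translates of themselves in different directions communicate. -/
theorem exists_reach_of_planeDet_ne (h : T.IsSpreadingPartition F s) {a b m n : ℤ × ℤ}
    (ha : Relation.TransGen (T.Leads F s) a (a + T.shift m))
    (hb : Relation.TransGen (T.Leads F s) b (b + T.shift n))
    (hmn : planeDet (latticePoint m) (latticePoint n) ≠ 0) :
    ∃ k, T.Reach F s a (b + T.shift k) := by
  have hb' := transGen_leads_symm hb
  have hb'' := h.symm.transGen_add_shift hb' (-n)
  rw [map_neg, add_neg_cancel_right, ← map_neg] at hb''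
  obtain ⟨γ, hγ, hγS, C, hC⟩ := (h.joined_future ha).exists_curve
    fun x hx k => h.add_shift_mem_future hx _
  obtain ⟨η, hη, hηS, D, hD⟩ := (h.symm.joined_future hb'').exists_curve
    fun x hx k => h.symm.add_shift_mem_future hx _
  obtain ⟨t, t', htt⟩ := exists_eq_of_transverse_directions hγ hη (p := latticePoint m)
    (q := latticePoint (-n)) (by
      rw [map_neg, ← zero_sub, planeDet_sub]
      intro h0
      apply hmn
      rw [show planeDet (latticePoint m) 0 = 0 by simp [planeDet]] at h0
      linarith) hC hD
  obtain ⟨c, ⟨k, hk⟩, l, hl⟩ := exists_mem_of_mem_region (hγS t) (htt ▸ hηS t')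
  refine ⟨l - k, ?_⟩
  have := h.reach_add_shift (hk.trans hl.symm) (-k)
  rwa [map_neg, add_neg_cancel_right, add_assoc, ← map_neg, ← map_add, ← sub_eq_add_neg] at this

theorem ne_zero_of_transGen (h : T.IsSpreadingPartition F s) {a m : ℤ × ℤ}
    (ha : Relation.TransGen (T.Leads F s) a (a + T.shift m)) : m ≠ 0 := by
  rintro rfl
  rw [map_zero, add_zero] at ha
  exact h.not_transGen h.bounded h.apply_ne a ha

/-- There are no spreading partitions. -/
theorem false_of_norm_lt (h : T.IsSpreadingPartition F s) {δ : ℝ}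
    (hδ : ∀ a, ∀ z ∈ T.tile a, ∀ w ∈ T.tile a, ‖z - w‖ < δ) : False := by
  have hreach : ∀ {a b m n : ℤ × ℤ}, Relation.TransGen (T.Leads F s) a (a + T.shift m) →
      Relation.TransGen (T.Leads F s) b (b + T.shift n) → ∃ k, T.Reach F s a (b + T.shift k) := by
    intro a b m n ha hb
    by_cases hmn : planeDet (latticePoint m) (latticePoint n) = 0
    · have hm := latticePoint_ne_zero (h.ne_zero_of_transGen ha)
      have hn := latticePoint_ne_zero (h.ne_zero_of_transGen hb)
      obtain ⟨c, l, hc, hl⟩ := h.exists_transGen_shift hδ hm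
      obtain ⟨k, hk⟩ := h.exists_reach_of_planeDet_ne ha hc hl.ne'
      obtain ⟨k', hk'⟩ := h.exists_reach_of_planeDet_ne hc hb fun h0 => hn (by
        simp only [planeDet] at hmn h0 hl
        refine Complex.ext ?_ ?_
        · rw [Complex.zero_re]
          refine (mul_eq_zero.1 (?_ : _ * ((latticePoint m).re * (latticePoint l).im -
            (latticePoint m).im * (latticePoint l).re) = 0)).resolve_right hl.ne'
          linear_combination (latticePoint l).re * hmn - (latticePoint m).re * h0
        · rw [Complex.zero_im]
          refine (mul_eq_zero.1 (?_ : _ * ((latticePoint m).re * (latticePoint l).im -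
            (latticePoint m).im * (latticePoint l).re) = 0)).resolve_right hl.ne'
          linear_combination (latticePoint l).im * hmn - (latticePoint m).im * h0)
      refine ⟨k' + k, ?_⟩
      rw [map_add, ← add_assoc]
      exact hk.trans (h.reach_add_shift hk' k)
    · exact h.exists_reach_of_planeDet_ne ha hb hmn
  obtain ⟨a, m, ha, -⟩ := h.exists_transGen_shift hδ one_ne_zero
  have hzero := zero_mem_of_add_mem
    (S := {m | Relation.TransGen (T.Leads F s) a (a + T.shift m)}) ?_ ?_
  · exact h.ne_zero_of_transGen hzero rfl
  · intro k hk l hl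
    change Relation.TransGen _ _ _
    have := h.transGen_add_shift hl k
    rw [add_assoc, ← map_add, add_comm l k] at this
    exact Relation.TransGen.trans hk this
  · intro u hu
    obtain ⟨b, n, hb, hn⟩ := h.exists_transGen_shift hδ hu
    obtain ⟨k, hk⟩ := hreach ha hb
    obtain ⟨l, hl⟩ := hreach hb ha
    obtain ⟨N, hN⟩ := exists_nat_gt (-planeDet u (latticePoint (k + l)) /
      planeDet u (latticePoint n))
    rw [div_lt_iff₀ hn] at hN
    have hmul : ∀ i : ℕ, Relation.TransGen (T.Leads F s) b (b + T.shift ((i + 1) • n)) := by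
      intro i
      induction i with
      | zero => rwa [zero_add, one_smul]
      | succ i ih =>
        have := h.transGen_add_shift hb ((i + 1) • n)
        rw [add_assoc, ← map_add, ← succ_nsmul'] at this
        exact ih.trans this
    refine ⟨l + ((N + 1) • n + k), ?_, ?_⟩
    · have h1 := hk.trans_transGen (h.transGen_add_shift (hmul N) k)
      have h2 := transGen_trans_reach h1 (h.reach_add_shift (h.reach_add_shift hl _) k)
      change Relation.TransGen _ _ _
      rwa [add_assoc, add_assoc, ← map_add, ← map_add] at h2
    · have e : latticePoint (l + ((N + 1) • n + k)) = latticePoint (k + l) +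
          ((N + 1 : ℕ) • latticePoint n) := by
        rw [← map_nsmul, ← map_add]
        congr 1
        abel
      have e2 : planeDet u ((N + 1 : ℕ) • latticePoint n) =
          (N + 1) * planeDet u (latticePoint n) := by
        rw [nsmul_eq_mul]
        simp only [planeDet, Complex.mul_re, Complex.mul_im, Complex.natCast_re,
          Complex.natCast_im]
        push_cast
        ring
      rw [e, planeDet_add, e2]
      linarith

end PlaneTiling.IsSpreadingPartition

/-- A plane homeomorphism commuting with the lattice translations which moves all points is not
spreading. -/
theorem not_isSpreading_of_le_norm_sub {F : ℂ ≃ₜ ℂ}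
    (hF : ∀ z m, F (z + latticePoint m) = F z + latticePoint m) (hB : HasBoundedDisplacement F)
    {δ : ℝ} (hδ : 0 < δ) (hfree : ∀ z, δ ≤ ‖F z - z‖) : ¬ IsSpreading F := by
  intro hS
  obtain ⟨T, hT⟩ := exists_planeTiling hδ
  obtain ⟨s, hs, hs'⟩ := PlaneTiling.exists_isFreePartition (T := T) hF fun a ⟨z, hz, hz'⟩ =>
    (hfree z).not_gt (hT a _ (PlaneTiling.core_subset_tile _ hz') _
      (PlaneTiling.core_subset_tile _ hz))
  have h : T.IsSpreadingPartition F s := { hs with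
    leads_or := hs'
    apply_add := hF
    bounded := hB
    spreading := hS
    apply_ne := fun z hz => by
      have := hfree z
      rw [hz, sub_self, norm_zero] at this
      linarith }
  exact h.false_of_norm_lt hT

section Periodic

variable {φ : ℂ → ℂ}

theorem exists_norm_le_of_periodic (hφ : Continuous φ)
    (hper : ∀ z m, φ (z + latticePoint m) = φ z) : ∃ C, ∀ z, ‖φ z‖ ≤ C := by
  obtain ⟨C, hC⟩ := (isCompact_closedBall (0 : ℂ) 2).exists_bound_of_continuousOn hφ.continuousOn
  refine ⟨C, fun z => ?_⟩
  obtain ⟨m, hm⟩ := exists_norm_add_latticePoint_sub_le z 0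
  rw [← hper z m]
  exact hC _ (mem_closedBall_iff_norm.2 hm)

theorem exists_le_norm_of_periodic (hφ : Continuous φ)
    (hper : ∀ z m, φ (z + latticePoint m) = φ z) (h0 : ∀ z, φ z ≠ 0) :
    ∃ δ > 0, ∀ z, δ ≤ ‖φ z‖ := by
  obtain ⟨z₀, -, hz₀⟩ := (isCompact_closedBall (0 : ℂ) 2).exists_isMinOn
    ⟨0, Metric.mem_closedBall_self zero_le_two⟩ hφ.norm.continuousOn
  refine ⟨‖φ z₀‖, norm_pos_iff.2 (h0 z₀), fun z => ?_⟩
  obtain ⟨m, hm⟩ := exists_norm_add_latticePoint_sub_le z 0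
  rw [← hper z m]
  exact hz₀ (mem_closedBall_iff_norm.2 hm)

end Periodic

theorem exists_homeomorph_iterate_sub (F : ℂ ≃ₜ ℂ) (v : ℂ) (n : ℕ) :
    ∃ G : ℂ ≃ₜ ℂ, ∀ z, G z = F^[n] z - v := by
  induction n with
  | zero => exact ⟨Homeomorph.subRight v, fun z => rfl⟩
  | succ n ih =>
    obtain ⟨G, hG⟩ := ih
    exact ⟨F.trans G, fun z => hG (F z)⟩

theorem norm_iterate_sub_le {F : ℂ → ℂ} {D : ℝ} (hD : ∀ z, ‖F z - z‖ ≤ D) (n : ℕ) (z : ℂ) :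
    ‖F^[n] z - z‖ ≤ n * D := by
  induction n with
  | zero => simp
  | succ n ih =>
    rw [Function.iterate_succ_apply', ← sub_add_sub_cancel _ (F^[n] z)]
    push_cast
    linarith [norm_add_le (F (F^[n] z) - F^[n] z) (F^[n] z - z), hD (F^[n] z)]

/-- If the orbits of `F` progress, in every direction, faster than the rotation by `p / q`, then
`F` has a periodic point of rotation vector `p / q`. -/
theorem exists_iterate_eq_add_latticePoint {F : ℂ ≃ₜ ℂ}
    (hF : ∀ z m, F (z + latticePoint m) = F z + latticePoint m) (p : ℤ × ℤ) {q : ℕ} (hq : 0 < q)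
    (hrot : ∀ u : ℂ, u ≠ 0 → ∃ w, planeDet u (latticePoint p) < q * planeDet u w ∧
      ∃ (n : ℕ → ℕ) (x : ℕ → ℂ), Tendsto n atTop atTop ∧
        Tendsto (fun k => ((n k : ℝ))⁻¹ • (F^[n k] (x k) - x k)) atTop (𝓝 w)) :
    ∃ z, F^[q] z = z + latticePoint p := by
  by_contra! hcon
  have hFn : ∀ n z m, F^[n] (z + latticePoint m) = F^[n] z + latticePoint m := fun n z m =>
    (Function.Semiconj.iterate_right (f := fun z => z + latticePoint m)
      (fun z => (hF z m).symm) n z).symm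
  obtain ⟨G, hG⟩ := exists_homeomorph_iterate_sub F (latticePoint p) q
  have hGF : ∀ z m, G (z + latticePoint m) = G z + latticePoint m := by
    intro z m
    rw [hG, hG, hFn]
    ring
  have hper : ∀ z m, G (z + latticePoint m) - (z + latticePoint m) = G z - z := by
    intro z m
    rw [hGF]
    ring
  obtain ⟨C, hC⟩ := exists_norm_le_of_periodic (φ := fun z => G z - z)
    (G.continuous.sub continuous_id) hper
  obtain ⟨δ, hδ, hδ'⟩ := exists_le_norm_of_periodic (φ := fun z => G z - z)
    (G.continuous.sub continuous_id) hper fun z hz => hcon z (by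
      rw [sub_eq_zero, hG, sub_eq_iff_eq_add] at hz
      exact hz)
  obtain ⟨D, hD⟩ := exists_norm_le_of_periodic (φ := fun z => F z - z)
    (F.continuous.sub continuous_id) (fun z m => by rw [hF]; ring)
  have hD0 : 0 ≤ D := (norm_nonneg _).trans (hD 0)
  refine not_isSpreading_of_le_norm_sub hGF ⟨C, hC⟩ hδ hδ' fun u hu B => ?_
  have hGiter : ∀ k z, G^[k] z = F^[q * k] z - latticePoint (k • p) := by
    intro k z
    induction k with
    | zero => simp
    | succ k ih =>
      have e : F^[q * k] z - latticePoint (k • p) = F^[q * k] z + latticePoint (-(k • p)) := by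
        rw [map_neg, sub_eq_add_neg]
      rw [Function.iterate_succ_apply', ih, e, hG, hFn,
        ← Function.iterate_add_apply, Nat.mul_succ, add_comm q, succ_nsmul, map_neg, map_add]
      ring
  obtain ⟨w, hw, n, x, hn, hx⟩ := hrot u hu
  set P := planeDet u (latticePoint p)
  have hq' : (0 : ℝ) < q := by exact_mod_cast hq
  have hlim := ((continuous_planeDet u).tendsto w).comp hx
  have hmid : (planeDet u w + P / q) / 2 < planeDet u w := by
    have : P / q < planeDet u w := by
      rw [div_lt_iff₀ hq']
      linarith
    linarith
  set ε := (planeDet u w - P / q) / 2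
  have hε : 0 < ε := by
    simp only [ε]
    linarith
  have hlarge : ∀ᶠ k in atTop, B + |P| + 2 * ‖u‖ * (q * D) < ε * n k :=
    ((tendsto_natCast_atTop_atTop.comp hn).const_mul_atTop hε).eventually_gt_atTop _
  obtain ⟨k, hk1, hk2, hk3⟩ := ((hlim.eventually (lt_mem_nhds hmid)).and
    (hlarge.and (hn.eventually_gt_atTop 0))).exists
  have hn0 : (0 : ℝ) < n k := by exact_mod_cast hk3
  rw [Function.comp, planeDet_smul, ← div_eq_inv_mul, lt_div_iff₀ hn0] at hk1
  refine ⟨x k, n k / q, ?_⟩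
  have e1 : F^[n k] (x k) = F^[n k % q] (F^[q * (n k / q)] (x k)) := by
    rw [← Function.iterate_add_apply, Nat.mod_add_div]
  have e2 : G^[n k / q] (x k) - x k = F^[n k] (x k) - x k -
      (F^[n k % q] (F^[q * (n k / q)] (x k)) - F^[q * (n k / q)] (x k)) -
      ((n k / q : ℕ) : ℝ) • latticePoint p := by
    rw [hGiter, e1, map_nsmul, ← Nat.cast_smul_eq_nsmul ℝ]
    ring
  have h1 := (le_abs_self _).trans ((abs_planeDet_le u _).trans (mul_le_mul_of_nonneg_left
    ((norm_iterate_sub_le hD (n k % q) (F^[q * (n k / q)] (x k))).trans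
      (mul_le_mul_of_nonneg_right (Nat.cast_le.2 (Nat.mod_lt _ hq).le) hD0))
    (show 0 ≤ 2 * ‖u‖ by positivity)))
  rw [e2, planeDet_sub, planeDet_sub, planeDet_smul]
  have h2 : -|P| ≤ (n k : ℝ) * (P / q) - (n k / q : ℕ) * P := by
    have e3 : (n k : ℝ) = (n k % q : ℕ) + q * (n k / q : ℕ) := by
      exact_mod_cast (Nat.mod_add_div (n k) q).symm
    have e4 : (n k : ℝ) * (P / q) - (n k / q : ℕ) * P = ((n k % q : ℕ) / (q : ℝ)) * P := by
      rw [e3]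
      field_simp
      ring
    rw [e4]
    refine neg_le_of_abs_le ?_
    rw [abs_mul, abs_of_nonneg (by positivity)]
    refine mul_le_of_le_one_left (abs_nonneg _) ?_
    rw [div_le_one hq']
    exact_mod_cast (Nat.mod_lt _ hq).le
  have h3 : (planeDet u w + P / q) / 2 * n k = ε * n k + n k * (P / q) := by
    simp only [ε]
    ring
  linarith

/-- (Franks) Let `F : ℝ² → ℝ²` be a homeomorphism commuting with all integer translations
(a lift of a torus homeomorphism isotopic to the identity) with rotation set
`ρ(F) = {v : ∃ nₖ → ∞, xₖ with (F^[nₖ] xₖ - xₖ)/nₖ → v}`. If the rational vector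
`v = (p₁/q, p₂/q)` lies in the interior of `ρ(F)`, then there exists `x₀ ∈ ℝ²` with
`F^[q] x₀ = x₀ + (p₁, p₂)`, i.e. the torus homeomorphism has a periodic point with
rotation vector `v`. -/
theorem franks_periodic_point_of_interior_rational
    (F : (ℝ × ℝ) ≃ₜ (ℝ × ℝ))
    (hF_per : ∀ (x : ℝ × ℝ) (m : ℤ × ℤ),
      F (x + ((m.1 : ℝ), (m.2 : ℝ))) = F x + ((m.1 : ℝ), (m.2 : ℝ)))
    (p₁ p₂ : ℤ) (q : ℕ) (hq : 1 ≤ q)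
    (hv : ((p₁ : ℝ) / (q : ℝ), (p₂ : ℝ) / (q : ℝ)) ∈
      interior {v : ℝ × ℝ | ∃ (n : ℕ → ℕ) (x : ℕ → ℝ × ℝ), Tendsto n atTop atTop ∧
        Tendsto (fun k => ((n k : ℝ))⁻¹ • ((⇑F)^[n k] (x k) - x k)) atTop (𝓝 v)}) :
    ∃ x₀ : ℝ × ℝ, (⇑F)^[q] x₀ = x₀ + ((p₁ : ℝ), (p₂ : ℝ)) := by
  let e : (ℝ × ℝ) ≃L[ℝ] ℂ := Complex.equivRealProdCLM.symm
  have he : ∀ m : ℤ × ℤ, e ((m.1 : ℝ), (m.2 : ℝ)) = latticePoint m := fun m =>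
    Complex.ext (by rw [latticePoint_re]; rfl) (by rw [latticePoint_im]; rfl)
  have hq' : (0 : ℝ) < q := by exact_mod_cast hq
  let G : ℂ ≃ₜ ℂ := e.symm.toHomeomorph.trans (F.trans e.toHomeomorph)
  have hG : ∀ x, G (e x) = e (F x) := fun x => congrArg (fun y => e (F y)) (e.symm_apply_apply x)
  have hGn : ∀ n x, G^[n] (e x) = e (F^[n] x) := fun n x =>
    (Function.Semiconj.iterate_right (f := e) (fun x => (hG x).symm) n x).symm
  have hper : ∀ z m, G (z + latticePoint m) = G z + latticePoint m := by
    intro z m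
    obtain ⟨x, rfl⟩ := e.surjective z
    rw [← he, ← map_add, hG, hG, hF_per, map_add]
  obtain ⟨z, hz⟩ := exists_iterate_eq_add_latticePoint hper (p₁, p₂) hq <| by
    intro u hu
    obtain ⟨d, hd⟩ := exists_planeDet_eq hu 1
    obtain ⟨d, rfl⟩ := e.surjective d
    set v : ℝ × ℝ := ((p₁ : ℝ) / (q : ℝ), (p₂ : ℝ) / (q : ℝ))
    have hcont : Tendsto (fun t : ℝ => v + t • d) (𝓝[>] 0) (𝓝 v) := by
      have : Continuous fun t : ℝ => v + t • d := by fun_prop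
      simpa using (this.tendsto 0).mono_left nhdsWithin_le_nhds
    obtain ⟨t, ⟨n, x, hn, hx⟩, ht⟩ := ((hcont.eventually (mem_interior_iff_mem_nhds.1 hv)).and
      self_mem_nhdsWithin).exists
    refine ⟨e (v + t • d), ?_, n, fun k => e (x k), hn, ?_⟩
    · have hqv : (q : ℝ) • v = ((p₁ : ℝ), (p₂ : ℝ)) :=
        Prod.ext (mul_div_cancel₀ _ hq'.ne') (mul_div_cancel₀ _ hq'.ne')
      have hlp : latticePoint (p₁, p₂) = (q : ℝ) • e v := by
        rw [← he, ← map_smul, hqv]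
      rw [hlp, map_add, map_smul, planeDet_add, planeDet_smul, planeDet_smul, hd]
      have : 0 < (q : ℝ) * t := mul_pos hq' ht
      linarith
    · refine ((e.continuous.tendsto _).comp hx).congr fun k => ?_
      rw [Function.comp, map_smul, map_sub, hGn]

  obtain ⟨x, rfl⟩ := e.surjective z
  refine ⟨x, e.injective ?_⟩
  rw [← hGn, hz, map_add, ← he]
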